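/- There exist ε₀ > 0, C₁ > 0, and M > 1 such that for all 0 < ε ≤ ε₀ the following holds: if a B₀ T²-symmetric Einstein flow and a time s₀ > 0 satisfy at τ = s₀ the conditions |A| < 1, ρ₀ := inf_{S¹} ρ(·, s₀) > 0, |c(s₀)| < ε, |d(s₀)| < ε, |ΠE/H − 1|(s₀) < 1, (1/2)ε^{−1} < e^{s₀} < 2ε^{−1}, e^{s₀}H(s₀) + C₁ε^{1/2} < M ε e^{s₀}, and 0 < 1/M < e^{s₀}H(s₀) − C₁ε^{1/2}, then for all τ ∈ [s₀, ∞) the estimates |c(τ)| < ε^{1/4}, |d(τ)| < ε^{1/4}, |ΠE/H − 1|(τ) < 3, and (1/2)(e^{s₀}H(s₀) − C₁ε^{1/2}) < e^{τ}H(τ) < 2(e^{s₀}H(s₀) + C₁ε^{1/2}) hold. -/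

import Mathlib

noncomputable section

open Real MeasureTheory intervalIntegral

/-- The θ-mean of a function on the circle of circumference 1 (total measure 1). -/
def circleMean (f : ℝ → ℝ) : ℝ := ∫ θ in (0:ℝ)..1, f θ

/-- The smooth, θ-periodic fields `V, Q, ρ, l` of a T²-symmetric spacetime in areal
coordinates; first argument is `τ`, second is `θ`. -/
structure T2Flow where
  V : ℝ → ℝ → ℝ
  Q : ℝ → ℝ → ℝ
  ρ : ℝ → ℝ → ℝ
  l : ℝ → ℝ → ℝ
  smooth_V : ContDiff ℝ (⊤ : ℕ∞) (Function.uncurry V)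
  smooth_Q : ContDiff ℝ (⊤ : ℕ∞) (Function.uncurry Q)
  smooth_ρ : ContDiff ℝ (⊤ : ℕ∞) (Function.uncurry ρ)
  smooth_l : ContDiff ℝ (⊤ : ℕ∞) (Function.uncurry l)
  periodic_V : ∀ τ, Function.Periodic (V τ) 1
  periodic_Q : ∀ τ, Function.Periodic (Q τ) 1
  periodic_ρ : ∀ τ, Function.Periodic (ρ τ) 1
  periodic_l : ∀ τ, Function.Periodic (l τ) 1

namespace T2Flow

/-- `V_τ`. -/
def Vτ (F : T2Flow) (τ θ : ℝ) : ℝ := deriv (fun s => F.V s θ) τ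
/-- `V_θ`. -/
def Vθ (F : T2Flow) (τ θ : ℝ) : ℝ := deriv (fun x => F.V τ x) θ
/-- `Q_τ`. -/
def Qτ (F : T2Flow) (τ θ : ℝ) : ℝ := deriv (fun s => F.Q s θ) τ
/-- `Q_θ`. -/
def Qθ (F : T2Flow) (τ θ : ℝ) : ℝ := deriv (fun x => F.Q τ x) θ
/-- `ρ_τ`. -/
def ρτ (F : T2Flow) (τ θ : ℝ) : ℝ := deriv (fun s => F.ρ s θ) τ
/-- `l_τ`. -/
def lτ (F : T2Flow) (τ θ : ℝ) : ℝ := deriv (fun s => F.l s θ) τ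
/-- `l_θ`. -/
def lθ (F : T2Flow) (τ θ : ℝ) : ℝ := deriv (fun x => F.l τ x) θ

/-- The energy density
`J = (1/2)[V_τ² + e^{2(τ−ρ)}V_θ² + e^{2(V−τ)}(Q_τ² + e^{2(τ−ρ)}Q_θ²)]`. -/
def J (F : T2Flow) (τ θ : ℝ) : ℝ :=
  (1/2) * (F.Vτ τ θ ^ 2 + exp (2*(τ - F.ρ τ θ)) * F.Vθ τ θ ^ 2
    + exp (2*(F.V τ θ - τ)) * (F.Qτ τ θ ^ 2 + exp (2*(τ - F.ρ τ θ)) * F.Qθ τ θ ^ 2))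

/-- The T²-symmetric vacuum Einstein evolution equations together with the
momentum constraint. -/
def IsEinsteinFlow (F : T2Flow) : Prop :=
  (∀ τ θ : ℝ, deriv (fun s => exp (F.ρ s θ) * F.Vτ s θ) τ
      = deriv (fun x => exp (2*τ - F.ρ τ x) * F.Vθ τ x) θ
        + exp (2*(F.V τ θ - τ) + F.ρ τ θ)
          * (F.Qτ τ θ ^ 2 - exp (2*(τ - F.ρ τ θ)) * F.Qθ τ θ ^ 2)) ∧
  (∀ τ θ : ℝ, deriv (fun s => exp (F.ρ s θ + 2*(F.V s θ - s)) * F.Qτ s θ) τ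
      = deriv (fun x => exp (-F.ρ τ x + 2*F.V τ x) * F.Qθ τ x) θ) ∧
  (∀ τ θ : ℝ, F.lτ τ θ + F.ρτ τ θ + 2 = F.J τ θ) ∧
  (∀ τ θ : ℝ, F.ρτ τ θ = exp (F.l τ θ)) ∧
  (∀ τ θ : ℝ, F.lθ τ θ = F.Vθ τ θ * F.Vτ τ θ
      + exp (2*(F.V τ θ - τ)) * F.Qθ τ θ * F.Qτ τ θ)

/-- The conserved quantity `A = ∫ e^ρ (V_τ − e^{2(V−τ)} Q_τ Q) dθ`. -/
def A (F : T2Flow) (τ : ℝ) : ℝ :=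
  ∫ θ in (0:ℝ)..1,
    exp (F.ρ τ θ) * (F.Vτ τ θ - exp (2*(F.V τ θ - τ)) * F.Qτ τ θ * F.Q τ θ)

/-- The conserved quantity `B = ∫ e^{ρ+2(V−τ)} Q_τ dθ`. -/
def B (F : T2Flow) (τ : ℝ) : ℝ :=
  ∫ θ in (0:ℝ)..1, exp (F.ρ τ θ + 2*(F.V τ θ - τ)) * F.Qτ τ θ

/-- The energy `E = ∫ e^{ρ−2τ} J dθ`. -/
def E (F : T2Flow) (τ : ℝ) : ℝ := ∫ θ in (0:ℝ)..1, exp (F.ρ τ θ - 2*τ) * F.J τ θ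

/-- The `S¹`-volume `Π = ⟨e^ρ⟩`. -/
def Pi (F : T2Flow) (τ : ℝ) : ℝ := ∫ θ in (0:ℝ)..1, exp (F.ρ τ θ)

/-- The correction `Λ = (1/2) e^{−2τ} ∫ V_τ (V − ⟨V⟩ − 1) e^ρ dθ`. -/
def Λ (F : T2Flow) (τ : ℝ) : ℝ :=
  (1/2) * exp (-2*τ) *
    ∫ θ in (0:ℝ)..1, F.Vτ τ θ * (F.V τ θ - circleMean (F.V τ) - 1) * exp (F.ρ τ θ)

/-- The corrected, normalized energy `H = Π (E + Λ)`. -/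
def H (F : T2Flow) (τ : ℝ) : ℝ := F.Pi τ * (F.E τ + F.Λ τ)

/-- The twist potential `Y = ⟨e^{l+ρ+2τ}⟩`. -/
def Y (F : T2Flow) (τ : ℝ) : ℝ := ∫ θ in (0:ℝ)..1, exp (F.l τ θ + F.ρ τ θ + 2*τ)

/-- The error term `Ω = ⟨e^{l+ρ+2τ} J⟩ − e^{2τ} E Y Π⁻¹`. -/
def Ω (F : T2Flow) (τ : ℝ) : ℝ :=
  (∫ θ in (0:ℝ)..1, exp (F.l τ θ + F.ρ τ θ + 2*τ) * F.J τ θ)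
    - exp (2*τ) * F.E τ * F.Y τ / F.Pi τ

end T2Flow

namespace T2Flow

/-- The normalized quantity `c = Π/(e^τ √H) − 2/√10`. -/
def c (F : T2Flow) (τ : ℝ) : ℝ :=
  F.Pi τ / (Real.exp τ * Real.sqrt (F.H τ)) - 2 / Real.sqrt 10

/-- The normalized quantity `d = Y/(e^{3τ} √H) − 1/√10`. -/
def d (F : T2Flow) (τ : ℝ) : ℝ :=
  F.Y τ / (Real.exp (3*τ) * Real.sqrt (F.H τ)) - 1 / Real.sqrt 10

end T2Flow

/-- The quadratic nonlinearity `f(c,d) = ((10c − 10d + 3√10)/4)c² − √10 c d`. -/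
def fquad (c d : ℝ) : ℝ :=
  ((10*c - 10*d + 3*Real.sqrt 10) / 4) * c ^ 2 - Real.sqrt 10 * (c * d)

namespace T2Flow

/-- The error vector `Ω̃` of the linearized `(c,d)` system. -/
def Ωtilde (F : T2Flow) (τ : ℝ) : ℝ × ℝ :=
  (-(1/2) * deriv (fun s => Real.log (Real.exp s * F.H s)) τ * (2 / Real.sqrt 10),
   -(1/2) * deriv (fun s => Real.log (Real.exp s * F.H s)) τ * (1 / Real.sqrt 10)
     + fquad (F.d τ) (F.c τ) / (F.c τ + 2 / Real.sqrt 10) ^ 2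
     + (F.Pi τ * F.E τ / F.H τ - 1) * (F.d τ + 1 / Real.sqrt 10)
         / (F.c τ + 2 / Real.sqrt 10) ^ 2
     + F.Ω τ / (Real.exp (3*τ) * Real.sqrt (F.H τ)))

end T2Flow

section Calculus

/-- Partial derivative in the first variable. -/
def partialFst (f : ℝ → ℝ → ℝ) (τ θ : ℝ) : ℝ := deriv (fun s => f s θ) τ

/-- Partial derivative in the second variable. -/
def partialSnd (f : ℝ → ℝ → ℝ) (τ θ : ℝ) : ℝ := deriv (fun x => f τ x) θ

/-- Joint smoothness of a function of two real variables. -/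
def Smooth₂ (f : ℝ → ℝ → ℝ) : Prop := ContDiff ℝ (⊤ : ℕ∞) (Function.uncurry f)

variable {f g : ℝ → ℝ → ℝ}

lemma Smooth₂.hasDerivAt_fst_fderiv (hf : Smooth₂ f) (τ θ : ℝ) :
    HasDerivAt (fun s => f s θ) (fderiv ℝ (Function.uncurry f) (τ, θ) (1, 0)) τ := by
  have h1 : HasFDerivAt (Function.uncurry f) (fderiv ℝ (Function.uncurry f) (τ, θ)) (τ, θ) :=
    (ContDiff.differentiable hf (by simp)).differentiableAt.hasFDerivAt
  have h2 : HasDerivAt (fun s : ℝ => (s, θ)) ((1 : ℝ), (0 : ℝ)) τ :=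
    (hasDerivAt_id τ).prodMk (hasDerivAt_const τ θ)
  exact h1.comp_hasDerivAt τ h2

lemma Smooth₂.hasDerivAt_snd_fderiv (hf : Smooth₂ f) (τ θ : ℝ) :
    HasDerivAt (fun x => f τ x) (fderiv ℝ (Function.uncurry f) (τ, θ) (0, 1)) θ := by
  have h1 : HasFDerivAt (Function.uncurry f) (fderiv ℝ (Function.uncurry f) (τ, θ)) (τ, θ) :=
    (ContDiff.differentiable hf (by simp)).differentiableAt.hasFDerivAt
  have h2 : HasDerivAt (fun x : ℝ => (τ, x)) ((0 : ℝ), (1 : ℝ)) θ :=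
    (hasDerivAt_const θ τ).prodMk (hasDerivAt_id θ)
  exact h1.comp_hasDerivAt θ h2

lemma Smooth₂.partialFst_eq (hf : Smooth₂ f) (τ θ : ℝ) :
    partialFst f τ θ = fderiv ℝ (Function.uncurry f) (τ, θ) (1, 0) :=
  (hf.hasDerivAt_fst_fderiv τ θ).deriv

lemma Smooth₂.partialSnd_eq (hf : Smooth₂ f) (τ θ : ℝ) :
    partialSnd f τ θ = fderiv ℝ (Function.uncurry f) (τ, θ) (0, 1) :=
  (hf.hasDerivAt_snd_fderiv τ θ).deriv

lemma Smooth₂.hasDerivAt_fst (hf : Smooth₂ f) (τ θ : ℝ) :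
    HasDerivAt (fun s => f s θ) (partialFst f τ θ) τ := by
  rw [hf.partialFst_eq]; exact hf.hasDerivAt_fst_fderiv τ θ

lemma Smooth₂.hasDerivAt_snd (hf : Smooth₂ f) (τ θ : ℝ) :
    HasDerivAt (fun x => f τ x) (partialSnd f τ θ) θ := by
  rw [hf.partialSnd_eq]; exact hf.hasDerivAt_snd_fderiv τ θ

lemma Smooth₂.contDiff_fderiv_apply (hf : Smooth₂ f) (v : ℝ × ℝ) :
    ContDiff ℝ (⊤ : ℕ∞) (fun p => fderiv ℝ (Function.uncurry f) p v) :=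
  (ContDiff.fderiv_right (m := (⊤ : ℕ∞)) hf (by simp)).clm_apply contDiff_const

lemma Smooth₂.partialFst (hf : Smooth₂ f) : Smooth₂ (partialFst f) := by
  have : Function.uncurry (_root_.partialFst f)
      = fun p => fderiv ℝ (Function.uncurry f) p (1, 0) := by
    ext ⟨τ, θ⟩; exact hf.partialFst_eq τ θ
  rw [Smooth₂, this]; exact hf.contDiff_fderiv_apply _

lemma Smooth₂.partialSnd (hf : Smooth₂ f) : Smooth₂ (partialSnd f) := by
  have : Function.uncurry (_root_.partialSnd f)
      = fun p => fderiv ℝ (Function.uncurry f) p (0, 1) := by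
    ext ⟨τ, θ⟩; exact hf.partialSnd_eq τ θ
  rw [Smooth₂, this]; exact hf.contDiff_fderiv_apply _

lemma Smooth₂.partial_comm (hf : Smooth₂ f) (τ θ : ℝ) :
    _root_.partialFst (_root_.partialSnd f) τ θ = _root_.partialSnd (_root_.partialFst f) τ θ := by
  have hsymm : IsSymmSndFDerivAt ℝ (Function.uncurry f) (τ, θ) :=
    ContDiffAt.isSymmSndFDerivAt (ContDiff.contDiffAt hf)
      (by simpa using WithTop.coe_le_coe.2 (le_top : (2 : ℕ∞) ≤ ⊤))
  have hd : DifferentiableAt ℝ (fderiv ℝ (Function.uncurry f)) (τ, θ) :=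
    ((ContDiff.fderiv_right (m := (⊤ : ℕ∞)) hf (by simp)).differentiable (by simp)) _
  have key : ∀ v w : ℝ × ℝ, fderiv ℝ (fun p => fderiv ℝ (Function.uncurry f) p v) (τ, θ) w
      = fderiv ℝ (fderiv ℝ (Function.uncurry f)) (τ, θ) w v := by
    intro v w
    rw [fderiv_clm_apply hd (by fun_prop)]
    simp
  have e1 : Function.uncurry (_root_.partialFst f)
      = fun p => fderiv ℝ (Function.uncurry f) p (1, 0) := by
    ext ⟨τ, θ⟩; exact hf.partialFst_eq τ θ
  have e2 : Function.uncurry (_root_.partialSnd f)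
      = fun p => fderiv ℝ (Function.uncurry f) p (0, 1) := by
    ext ⟨τ, θ⟩; exact hf.partialSnd_eq τ θ
  rw [hf.partialSnd.partialFst_eq, hf.partialFst.partialSnd_eq, e1, e2, key, key]
  exact hsymm.eq _ _

lemma Smooth₂.continuous_comp (hf : Smooth₂ f) {X : Type*} [TopologicalSpace X] {a b : X → ℝ}
    (ha : Continuous a) (hb : Continuous b) : Continuous (fun x => f (a x) (b x)) :=
  (ContDiff.continuous hf).comp (ha.prodMk hb)

lemma periodic_partialFst (hf : ∀ τ, Function.Periodic (f τ) 1) (τ : ℝ) :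
    Function.Periodic (partialFst f τ) 1 := by
  intro θ
  simp only [partialFst]
  congr 1; ext s; exact hf s θ

lemma periodic_partialSnd (hf : ∀ τ, Function.Periodic (f τ) 1) (τ : ℝ) :
    Function.Periodic (partialSnd f τ) 1 := by
  intro θ
  simp only [partialSnd]
  rw [← deriv_comp_add_const]
  congr 1; ext x; exact hf τ x

/-- Differentiation under the integral over the circle. -/
lemma hasDerivAt_integral_unit {f' : ℝ → ℝ → ℝ}
    (hf : ∀ τ, Continuous (f τ)) (hf' : Continuous (fun p : ℝ × ℝ => f' p.1 p.2))
    (h : ∀ τ θ, HasDerivAt (fun s => f s θ) (f' τ θ) τ) (τ : ℝ) :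
    HasDerivAt (fun t => ∫ θ in (0:ℝ)..1, f t θ) (∫ θ in (0:ℝ)..1, f' τ θ) τ := by
  obtain ⟨K, hK⟩ := ((isCompact_Icc (a := τ - 1) (b := τ + 1)).prod
    (isCompact_Icc (a := (0:ℝ)) (b := 1))).exists_bound_of_continuousOn hf'.continuousOn
  have hf'c : Continuous (f' τ) := hf'.comp (Continuous.prodMk_right τ)
  refine (intervalIntegral.hasDerivAt_integral_of_dominated_loc_of_deriv_le
    (s := Set.Icc (τ - 1) (τ + 1)) (bound := fun _ => K)
    (Icc_mem_nhds (by linarith) (by linarith))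
    (Filter.Eventually.of_forall fun t => (hf t).aestronglyMeasurable)
    ((hf τ).intervalIntegrable _ _) hf'c.aestronglyMeasurable ?_
    (continuous_const.intervalIntegrable _ _) ?_).2
  · refine Filter.Eventually.of_forall fun θ hθ t ht => ?_
    rw [Set.uIoc_of_le zero_le_one] at hθ
    exact hK (t, θ) ⟨ht, ⟨hθ.1.le, hθ.2⟩⟩
  · exact Filter.Eventually.of_forall fun θ _ t _ => h t θ

/-- The integral of the derivative of a periodic function over a period vanishes. -/
lemma integral_unit_deriv_periodic {w w' : ℝ → ℝ} (hw : Function.Periodic w 1)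
    (h : ∀ θ, HasDerivAt w (w' θ) θ) (hc : Continuous w') :
    ∫ θ in (0:ℝ)..1, w' θ = 0 := by
  rw [intervalIntegral.integral_eq_sub_of_hasDerivAt (fun θ _ => h θ)
    (hc.intervalIntegrable _ _)]
  have := hw 0
  rw [zero_add] at this
  rw [this, sub_self]

lemma integral_unit_mono {u v : ℝ → ℝ} (hu : Continuous u) (hv : Continuous v)
    (h : ∀ θ ∈ Set.Icc (0:ℝ) 1, u θ ≤ v θ) :
    ∫ θ in (0:ℝ)..1, u θ ≤ ∫ θ in (0:ℝ)..1, v θ :=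
  intervalIntegral.integral_mono_on zero_le_one (hu.intervalIntegrable _ _)
    (hv.intervalIntegrable _ _) h

lemma integral_unit_nonneg {u : ℝ → ℝ} (h : ∀ θ, 0 ≤ u θ) :
    0 ≤ ∫ θ in (0:ℝ)..1, u θ :=
  intervalIntegral.integral_nonneg zero_le_one fun θ _ => h θ

lemma integral_unit_add {u v : ℝ → ℝ} (hu : Continuous u) (hv : Continuous v) :
    ∫ θ in (0:ℝ)..1, (u θ + v θ) = (∫ θ in (0:ℝ)..1, u θ) + ∫ θ in (0:ℝ)..1, v θ :=
  intervalIntegral.integral_add (hu.intervalIntegrable _ _) (hv.intervalIntegrable _ _)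

lemma integral_unit_sub {u v : ℝ → ℝ} (hu : Continuous u) (hv : Continuous v) :
    ∫ θ in (0:ℝ)..1, (u θ - v θ) = (∫ θ in (0:ℝ)..1, u θ) - ∫ θ in (0:ℝ)..1, v θ :=
  intervalIntegral.integral_sub (hu.intervalIntegrable _ _) (hv.intervalIntegrable _ _)

lemma abs_integral_unit_le {u v : ℝ → ℝ} (hu : Continuous u) (hv : Continuous v)
    (h : ∀ θ ∈ Set.Icc (0:ℝ) 1, |u θ| ≤ v θ) :
    |∫ θ in (0:ℝ)..1, u θ| ≤ ∫ θ in (0:ℝ)..1, v θ :=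
  (intervalIntegral.abs_integral_le_integral_abs zero_le_one).trans
    (integral_unit_mono hu.abs hv h)

/-- The oscillation of a function over the unit interval is at most the integral of a bound
for its derivative. -/
lemma abs_sub_le_integral_unit {w w' v : ℝ → ℝ} (h : ∀ θ, HasDerivAt w (w' θ) θ)
    (hc : Continuous w') (hv : Continuous v) (hle : ∀ θ, |w' θ| ≤ v θ)
    {x y : ℝ} (hx : x ∈ Set.Icc (0:ℝ) 1) (hy : y ∈ Set.Icc (0:ℝ) 1) :
    |w x - w y| ≤ ∫ θ in (0:ℝ)..1, v θ := by
  wlog hxy : y ≤ x generalizing x y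
  · rw [abs_sub_comm]; exact this hy hx (le_of_not_ge hxy)
  rw [← intervalIntegral.integral_eq_sub_of_hasDerivAt (fun θ _ => h θ)
    (hc.intervalIntegrable _ _)]
  have h0 : ∀ θ, 0 ≤ v θ := fun θ => (abs_nonneg _).trans (hle θ)
  calc |∫ θ in y..x, w' θ| ≤ ∫ θ in y..x, |w' θ| :=
        intervalIntegral.abs_integral_le_integral_abs hxy
    _ ≤ ∫ θ in y..x, v θ := intervalIntegral.integral_mono_on hxy
        (hc.abs.intervalIntegrable _ _) (hv.intervalIntegrable _ _) fun θ _ => hle θ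
    _ ≤ ∫ θ in (0:ℝ)..1, v θ := intervalIntegral.integral_mono_interval hy.1 hxy hx.2
        (Filter.Eventually.of_forall h0) (hv.intervalIntegrable _ _)

end Calculus

namespace T2Flow

section Derivatives

variable (F : T2Flow)

/-- `V_ττ`. -/
def Vττ (τ θ : ℝ) : ℝ := partialFst F.Vτ τ θ
/-- `V_τθ`. -/
def Vτθ (τ θ : ℝ) : ℝ := partialSnd F.Vτ τ θ
/-- `V_θθ`. -/
def Vθθ (τ θ : ℝ) : ℝ := partialSnd F.Vθ τ θ
/-- `Q_ττ`. -/
def Qττ (τ θ : ℝ) : ℝ := partialFst F.Qτ τ θ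
/-- `Q_τθ`. -/
def Qτθ (τ θ : ℝ) : ℝ := partialSnd F.Qτ τ θ
/-- `Q_θθ`. -/
def Qθθ (τ θ : ℝ) : ℝ := partialSnd F.Qθ τ θ
/-- `ρ_θ`. -/
def ρθ (τ θ : ℝ) : ℝ := partialSnd F.ρ τ θ

lemma smooth_Vτ : Smooth₂ F.Vτ := Smooth₂.partialFst F.smooth_V
lemma smooth_Vθ : Smooth₂ F.Vθ := Smooth₂.partialSnd F.smooth_V
lemma smooth_Qτ : Smooth₂ F.Qτ := Smooth₂.partialFst F.smooth_Q
lemma smooth_Qθ : Smooth₂ F.Qθ := Smooth₂.partialSnd F.smooth_Q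

section Continuity

variable {X : Type*} [TopologicalSpace X] {a b : X → ℝ}

@[fun_prop] lemma continuous_V (ha : Continuous a) (hb : Continuous b) :
    Continuous fun x => F.V (a x) (b x) := Smooth₂.continuous_comp F.smooth_V ha hb
@[fun_prop] lemma continuous_Q (ha : Continuous a) (hb : Continuous b) :
    Continuous fun x => F.Q (a x) (b x) := Smooth₂.continuous_comp F.smooth_Q ha hb
@[fun_prop] lemma continuous_ρ (ha : Continuous a) (hb : Continuous b) :
    Continuous fun x => F.ρ (a x) (b x) := Smooth₂.continuous_comp F.smooth_ρ ha hb
@[fun_prop] lemma continuous_l (ha : Continuous a) (hb : Continuous b) :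
    Continuous fun x => F.l (a x) (b x) := Smooth₂.continuous_comp F.smooth_l ha hb
@[fun_prop] lemma continuous_Vτ (ha : Continuous a) (hb : Continuous b) :
    Continuous fun x => F.Vτ (a x) (b x) := F.smooth_Vτ.continuous_comp ha hb
@[fun_prop] lemma continuous_Vθ (ha : Continuous a) (hb : Continuous b) :
    Continuous fun x => F.Vθ (a x) (b x) := F.smooth_Vθ.continuous_comp ha hb
@[fun_prop] lemma continuous_Qτ (ha : Continuous a) (hb : Continuous b) :
    Continuous fun x => F.Qτ (a x) (b x) := F.smooth_Qτ.continuous_comp ha hb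
@[fun_prop] lemma continuous_Qθ (ha : Continuous a) (hb : Continuous b) :
    Continuous fun x => F.Qθ (a x) (b x) := F.smooth_Qθ.continuous_comp ha hb
@[fun_prop] lemma continuous_ρτ (ha : Continuous a) (hb : Continuous b) :
    Continuous fun x => F.ρτ (a x) (b x) :=
  (Smooth₂.partialFst F.smooth_ρ).continuous_comp ha hb
@[fun_prop] lemma continuous_ρθ (ha : Continuous a) (hb : Continuous b) :
    Continuous fun x => F.ρθ (a x) (b x) :=
  (Smooth₂.partialSnd F.smooth_ρ).continuous_comp ha hb
@[fun_prop] lemma continuous_lθ (ha : Continuous a) (hb : Continuous b) :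
    Continuous fun x => F.lθ (a x) (b x) :=
  (Smooth₂.partialSnd F.smooth_l).continuous_comp ha hb
@[fun_prop] lemma continuous_lτ (ha : Continuous a) (hb : Continuous b) :
    Continuous fun x => F.lτ (a x) (b x) :=
  (Smooth₂.partialFst F.smooth_l).continuous_comp ha hb
@[fun_prop] lemma continuous_Vττ (ha : Continuous a) (hb : Continuous b) :
    Continuous fun x => F.Vττ (a x) (b x) := F.smooth_Vτ.partialFst.continuous_comp ha hb
@[fun_prop] lemma continuous_Vτθ (ha : Continuous a) (hb : Continuous b) :
    Continuous fun x => F.Vτθ (a x) (b x) := F.smooth_Vτ.partialSnd.continuous_comp ha hb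
@[fun_prop] lemma continuous_Vθθ (ha : Continuous a) (hb : Continuous b) :
    Continuous fun x => F.Vθθ (a x) (b x) := F.smooth_Vθ.partialSnd.continuous_comp ha hb
@[fun_prop] lemma continuous_Qττ (ha : Continuous a) (hb : Continuous b) :
    Continuous fun x => F.Qττ (a x) (b x) := F.smooth_Qτ.partialFst.continuous_comp ha hb
@[fun_prop] lemma continuous_Qτθ (ha : Continuous a) (hb : Continuous b) :
    Continuous fun x => F.Qτθ (a x) (b x) := F.smooth_Qτ.partialSnd.continuous_comp ha hb
@[fun_prop] lemma continuous_Qθθ (ha : Continuous a) (hb : Continuous b) :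
    Continuous fun x => F.Qθθ (a x) (b x) := F.smooth_Qθ.partialSnd.continuous_comp ha hb
@[fun_prop] lemma continuous_J (ha : Continuous a) (hb : Continuous b) :
    Continuous fun x => F.J (a x) (b x) := by
  unfold J; fun_prop

end Continuity

variable (τ θ : ℝ)

lemma hasDerivAt_V_fst : HasDerivAt (fun s => F.V s θ) (F.Vτ τ θ) τ :=
  Smooth₂.hasDerivAt_fst F.smooth_V τ θ
lemma hasDerivAt_V_snd : HasDerivAt (fun x => F.V τ x) (F.Vθ τ θ) θ :=
  Smooth₂.hasDerivAt_snd F.smooth_V τ θ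
lemma hasDerivAt_Q_fst : HasDerivAt (fun s => F.Q s θ) (F.Qτ τ θ) τ :=
  Smooth₂.hasDerivAt_fst F.smooth_Q τ θ
lemma hasDerivAt_Q_snd : HasDerivAt (fun x => F.Q τ x) (F.Qθ τ θ) θ :=
  Smooth₂.hasDerivAt_snd F.smooth_Q τ θ
lemma hasDerivAt_ρ_fst : HasDerivAt (fun s => F.ρ s θ) (F.ρτ τ θ) τ :=
  Smooth₂.hasDerivAt_fst F.smooth_ρ τ θ
lemma hasDerivAt_ρ_snd : HasDerivAt (fun x => F.ρ τ x) (F.ρθ τ θ) θ :=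
  Smooth₂.hasDerivAt_snd F.smooth_ρ τ θ
lemma hasDerivAt_l_fst : HasDerivAt (fun s => F.l s θ) (F.lτ τ θ) τ :=
  Smooth₂.hasDerivAt_fst F.smooth_l τ θ
lemma hasDerivAt_l_snd : HasDerivAt (fun x => F.l τ x) (F.lθ τ θ) θ :=
  Smooth₂.hasDerivAt_snd F.smooth_l τ θ
lemma hasDerivAt_Vτ_fst : HasDerivAt (fun s => F.Vτ s θ) (F.Vττ τ θ) τ :=
  F.smooth_Vτ.hasDerivAt_fst τ θ
lemma hasDerivAt_Vτ_snd : HasDerivAt (fun x => F.Vτ τ x) (F.Vτθ τ θ) θ :=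
  F.smooth_Vτ.hasDerivAt_snd τ θ
lemma hasDerivAt_Vθ_fst : HasDerivAt (fun s => F.Vθ s θ) (F.Vτθ τ θ) τ := by
  have h := F.smooth_Vθ.hasDerivAt_fst τ θ
  rwa [show partialFst F.Vθ τ θ = F.Vτθ τ θ from Smooth₂.partial_comm F.smooth_V τ θ] at h
lemma hasDerivAt_Vθ_snd : HasDerivAt (fun x => F.Vθ τ x) (F.Vθθ τ θ) θ :=
  F.smooth_Vθ.hasDerivAt_snd τ θ
lemma hasDerivAt_Qτ_fst : HasDerivAt (fun s => F.Qτ s θ) (F.Qττ τ θ) τ :=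
  F.smooth_Qτ.hasDerivAt_fst τ θ
lemma hasDerivAt_Qτ_snd : HasDerivAt (fun x => F.Qτ τ x) (F.Qτθ τ θ) θ :=
  F.smooth_Qτ.hasDerivAt_snd τ θ
lemma hasDerivAt_Qθ_fst : HasDerivAt (fun s => F.Qθ s θ) (F.Qτθ τ θ) τ := by
  have h := F.smooth_Qθ.hasDerivAt_fst τ θ
  rwa [show partialFst F.Qθ τ θ = F.Qτθ τ θ from Smooth₂.partial_comm F.smooth_Q τ θ] at h
lemma hasDerivAt_Qθ_snd : HasDerivAt (fun x => F.Qθ τ x) (F.Qθθ τ θ) θ :=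
  F.smooth_Qθ.hasDerivAt_snd τ θ

lemma periodic_Vτ : Function.Periodic (F.Vτ τ) 1 := periodic_partialFst F.periodic_V τ
lemma periodic_Vθ : Function.Periodic (F.Vθ τ) 1 := periodic_partialSnd F.periodic_V τ
lemma periodic_Qτ : Function.Periodic (F.Qτ τ) 1 := periodic_partialFst F.periodic_Q τ
lemma periodic_Qθ : Function.Periodic (F.Qθ τ) 1 := periodic_partialSnd F.periodic_Q τ

end Derivatives

section Evolution

lemma exp_two_mul' (x : ℝ) : exp (2 * x) = exp x ^ 2 := by
  rw [two_mul, exp_add, sq]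

variable {F : T2Flow} (hF : F.IsEinsteinFlow) (τ θ : ℝ)
include hF

lemma IsEinsteinFlow.V_evolution :
    exp (F.ρ τ θ) * (F.ρτ τ θ * F.Vτ τ θ + F.Vττ τ θ)
      = exp (2*τ - F.ρ τ θ) * (F.Vθθ τ θ - F.ρθ τ θ * F.Vθ τ θ)
        + exp (2*(F.V τ θ - τ) + F.ρ τ θ)
          * (F.Qτ τ θ ^ 2 - exp (2*(τ - F.ρ τ θ)) * F.Qθ τ θ ^ 2) := by
  have h := hF.1 τ θ
  rw [((F.hasDerivAt_ρ_fst τ θ).exp.fun_mul (F.hasDerivAt_Vτ_fst τ θ)).deriv,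
    (((F.hasDerivAt_ρ_snd τ θ).const_sub (2*τ)).exp.fun_mul (F.hasDerivAt_Vθ_snd τ θ)).deriv] at h
  linear_combination h

lemma IsEinsteinFlow.Q_evolution :
    exp (F.ρ τ θ + 2*(F.V τ θ - τ)) * ((F.ρτ τ θ + 2*(F.Vτ τ θ - 1)) * F.Qτ τ θ + F.Qττ τ θ)
      = exp (-F.ρ τ θ + 2*F.V τ θ)
        * ((-F.ρθ τ θ + 2*F.Vθ τ θ) * F.Qθ τ θ + F.Qθθ τ θ) := by
  have h := hF.2.1 τ θ
  rw [(((F.hasDerivAt_ρ_fst τ θ).fun_add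
      (((F.hasDerivAt_V_fst τ θ).fun_sub (hasDerivAt_id' τ)).const_mul 2)).exp.fun_mul
      (F.hasDerivAt_Qτ_fst τ θ)).deriv,
    (((F.hasDerivAt_ρ_snd τ θ).fun_neg.fun_add ((F.hasDerivAt_V_snd τ θ).const_mul 2)).exp.fun_mul
      (F.hasDerivAt_Qθ_snd τ θ)).deriv] at h
  linear_combination h

end Evolution

end T2Flow

namespace T2Flow

section IntegralDerivatives

/-- Kinetic energy density of `V`. -/
def kinV (F : T2Flow) (τ θ : ℝ) : ℝ := exp (F.ρ τ θ - 2*τ) * F.Vτ τ θ ^ 2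
/-- Kinetic energy density of `Q`. -/
def kinQ (F : T2Flow) (τ θ : ℝ) : ℝ :=
  exp (F.ρ τ θ - 2*τ + 2*(F.V τ θ - τ)) * F.Qτ τ θ ^ 2
/-- Gradient energy density of `V`. -/
def gradV (F : T2Flow) (τ θ : ℝ) : ℝ := exp (-F.ρ τ θ) * F.Vθ τ θ ^ 2
/-- Gradient energy density of `Q`. -/
def gradQ (F : T2Flow) (τ θ : ℝ) : ℝ := exp (-F.ρ τ θ + 2*(F.V τ θ - τ)) * F.Qθ τ θ ^ 2

/-- The energy density `e^{ρ−2τ} J`. -/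
def eDens (F : T2Flow) (τ θ : ℝ) : ℝ := exp (F.ρ τ θ - 2*τ) * F.J τ θ

/-- `∫ e^ρ V_τ`. -/
def P (F : T2Flow) (τ : ℝ) : ℝ := ∫ θ in (0:ℝ)..1, exp (F.ρ τ θ) * F.Vτ τ θ
/-- `∫ e^ρ V_τ V`. -/
def R (F : T2Flow) (τ : ℝ) : ℝ := ∫ θ in (0:ℝ)..1, exp (F.ρ τ θ) * F.Vτ τ θ * F.V τ θ
/-- `∫ e^ρ V`. -/
def S (F : T2Flow) (τ : ℝ) : ℝ := ∫ θ in (0:ℝ)..1, exp (F.ρ τ θ) * F.V τ θ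

variable {F : T2Flow}

lemma eDens_eq (τ θ : ℝ) : F.eDens τ θ =
    (1/2) * (F.kinV τ θ + F.kinQ τ θ + F.gradV τ θ + F.gradQ τ θ) := by
  simp only [eDens, J, kinV, kinQ, gradV, gradQ, exp_add, exp_sub, exp_neg, exp_two_mul']
  field_simp
  ring

lemma kinV_nonneg (τ θ : ℝ) : 0 ≤ F.kinV τ θ := by unfold kinV; positivity
lemma kinQ_nonneg (τ θ : ℝ) : 0 ≤ F.kinQ τ θ := by unfold kinQ; positivity
lemma gradV_nonneg (τ θ : ℝ) : 0 ≤ F.gradV τ θ := by unfold gradV; positivity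
lemma gradQ_nonneg (τ θ : ℝ) : 0 ≤ F.gradQ τ θ := by unfold gradQ; positivity

lemma eDens_nonneg (τ θ : ℝ) : 0 ≤ F.eDens τ θ := by
  rw [eDens_eq]
  linarith [F.kinV_nonneg τ θ, F.kinQ_nonneg τ θ, F.gradV_nonneg τ θ, F.gradQ_nonneg τ θ]

section Continuity

variable {X : Type*} [TopologicalSpace X] {a b : X → ℝ}

@[fun_prop] lemma continuous_kinV (ha : Continuous a) (hb : Continuous b) :
    Continuous fun x => F.kinV (a x) (b x) := by unfold kinV; fun_prop
@[fun_prop] lemma continuous_kinQ (ha : Continuous a) (hb : Continuous b) :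
    Continuous fun x => F.kinQ (a x) (b x) := by unfold kinQ; fun_prop
@[fun_prop] lemma continuous_gradV (ha : Continuous a) (hb : Continuous b) :
    Continuous fun x => F.gradV (a x) (b x) := by unfold gradV; fun_prop
@[fun_prop] lemma continuous_gradQ (ha : Continuous a) (hb : Continuous b) :
    Continuous fun x => F.gradQ (a x) (b x) := by unfold gradQ; fun_prop
@[fun_prop] lemma continuous_eDens (ha : Continuous a) (hb : Continuous b) :
    Continuous fun x => F.eDens (a x) (b x) := by unfold eDens; fun_prop

end Continuity

variable (hF : F.IsEinsteinFlow) (τ : ℝ)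
include hF

lemma IsEinsteinFlow.hasDerivAt_Pi :
    HasDerivAt F.Pi (∫ θ in (0:ℝ)..1, exp (F.l τ θ) * exp (F.ρ τ θ)) τ := by
  refine hasDerivAt_integral_unit (f := fun τ θ => exp (F.ρ τ θ))
    (f' := fun τ θ => exp (F.l τ θ) * exp (F.ρ τ θ)) (by fun_prop) (by fun_prop)
    (fun τ θ => ?_) τ
  have h := (F.hasDerivAt_ρ_fst τ θ).exp
  rw [hF.2.2.2.1, mul_comm] at h
  exact h

lemma IsEinsteinFlow.hasDerivAt_Y :
    HasDerivAt F.Y (exp (4*τ) * ∫ θ in (0:ℝ)..1, exp (F.l τ θ) * F.eDens τ θ) τ := by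
  have h := hasDerivAt_integral_unit (f := fun τ θ => exp (F.l τ θ + F.ρ τ θ + 2*τ))
    (f' := fun τ θ => exp (4*τ) * (exp (F.l τ θ) * F.eDens τ θ)) (by fun_prop) (by fun_prop)
    (fun τ θ => ?_) τ
  · exact h.congr_deriv (by rw [intervalIntegral.integral_const_mul])
  have h := (((F.hasDerivAt_l_fst τ θ).fun_add (F.hasDerivAt_ρ_fst τ θ)).fun_add
    ((hasDerivAt_id' τ).const_mul 2)).exp
  refine h.congr_deriv ?_
  rw [mul_one, hF.2.2.1, eDens, ← mul_assoc, ← mul_assoc, ← exp_add, ← exp_add]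
  ring_nf

lemma IsEinsteinFlow.hasDerivAt_S :
    HasDerivAt F.S (F.P τ + ∫ θ in (0:ℝ)..1, exp (F.l τ θ) * exp (F.ρ τ θ) * F.V τ θ) τ := by
  have h := hasDerivAt_integral_unit (f := fun τ θ => exp (F.ρ τ θ) * F.V τ θ)
    (f' := fun τ θ => exp (F.ρ τ θ) * F.Vτ τ θ + exp (F.l τ θ) * exp (F.ρ τ θ) * F.V τ θ)
    (by fun_prop) (by fun_prop) (fun τ θ => ?_) τ
  · refine h.congr_deriv ?_
    rw [integral_unit_add (by fun_prop) (by fun_prop), P]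
  refine ((F.hasDerivAt_ρ_fst τ θ).exp.fun_mul (F.hasDerivAt_V_fst τ θ)).congr_deriv ?_
  rw [hF.2.2.2.1]; ring

lemma IsEinsteinFlow.hasDerivAt_P :
    HasDerivAt F.P (exp (2*τ) * ∫ θ in (0:ℝ)..1, (F.kinQ τ θ - F.gradQ τ θ)) τ := by
  have h := hasDerivAt_integral_unit (f := fun τ θ => exp (F.ρ τ θ) * F.Vτ τ θ)
    (f' := fun τ θ => exp (F.ρ τ θ) * (F.ρτ τ θ * F.Vτ τ θ + F.Vττ τ θ))
    (by fun_prop) (by fun_prop) (fun τ θ => ?_) τ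
  · refine h.congr_deriv ?_
    have hw := integral_unit_deriv_periodic (w := fun x => exp (2*τ - F.ρ τ x) * F.Vθ τ x)
      (w' := fun θ => exp (2*τ - F.ρ τ θ) * (F.Vθθ τ θ - F.ρθ τ θ * F.Vθ τ θ))
      (fun x => by simp only [F.periodic_ρ τ x, F.periodic_Vθ τ x])
      (fun θ => (((F.hasDerivAt_ρ_snd τ θ).const_sub (2*τ)).exp.fun_mul
        (F.hasDerivAt_Vθ_snd τ θ)).congr_deriv (by ring)) (by fun_prop)
    rw [← intervalIntegral.integral_const_mul, ← sub_eq_zero,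
      ← integral_unit_sub (by fun_prop) (by fun_prop)]
    refine Eq.trans ?_ hw
    refine intervalIntegral.integral_congr fun θ _ => ?_
    simp only [hF.V_evolution, kinQ, gradQ, exp_add, exp_sub, exp_neg, exp_two_mul']
    field_simp
    ring
  exact ((F.hasDerivAt_ρ_fst τ θ).exp.fun_mul (F.hasDerivAt_Vτ_fst τ θ)).congr_deriv (by ring)

lemma IsEinsteinFlow.hasDerivAt_R :
    HasDerivAt F.R (exp (2*τ) * ((∫ θ in (0:ℝ)..1, (F.kinV τ θ - F.gradV τ θ))
      + ∫ θ in (0:ℝ)..1, (F.kinQ τ θ - F.gradQ τ θ) * F.V τ θ)) τ := by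
  have h := hasDerivAt_integral_unit (f := fun τ θ => exp (F.ρ τ θ) * F.Vτ τ θ * F.V τ θ)
    (f' := fun τ θ => exp (F.ρ τ θ) * (F.ρτ τ θ * F.Vτ τ θ + F.Vττ τ θ) * F.V τ θ
      + exp (F.ρ τ θ) * F.Vτ τ θ * F.Vτ τ θ)
    (by fun_prop) (by fun_prop) (fun τ θ => ?_) τ
  · refine h.congr_deriv ?_
    have hw := integral_unit_deriv_periodic
      (w := fun x => exp (2*τ - F.ρ τ x) * F.Vθ τ x * F.V τ x)
      (w' := fun θ => exp (2*τ - F.ρ τ θ) * (F.Vθθ τ θ - F.ρθ τ θ * F.Vθ τ θ) * F.V τ θ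
        + exp (2*τ - F.ρ τ θ) * F.Vθ τ θ * F.Vθ τ θ)
      (fun x => by simp only [F.periodic_ρ τ x, F.periodic_Vθ τ x, F.periodic_V τ x])
      (fun θ => ((((F.hasDerivAt_ρ_snd τ θ).const_sub (2*τ)).exp.fun_mul
        (F.hasDerivAt_Vθ_snd τ θ)).fun_mul (F.hasDerivAt_V_snd τ θ)).congr_deriv (by ring))
      (by fun_prop)
    rw [← integral_unit_add (by fun_prop) (by fun_prop),
      ← intervalIntegral.integral_const_mul, ← sub_eq_zero,
      ← integral_unit_sub (by fun_prop) (by fun_prop)]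
    refine Eq.trans ?_ hw
    refine intervalIntegral.integral_congr fun θ _ => ?_
    simp only [hF.V_evolution, kinV, gradV, kinQ, gradQ, exp_add, exp_sub, exp_neg, exp_two_mul']
    field_simp
    ring
  exact (((F.hasDerivAt_ρ_fst τ θ).exp.fun_mul (F.hasDerivAt_Vτ_fst τ θ)).fun_mul
    (F.hasDerivAt_V_fst τ θ)).congr_deriv (by ring)

lemma IsEinsteinFlow.hasDerivAt_A : HasDerivAt F.A 0 τ := by
  have h := hasDerivAt_integral_unit (f := fun τ θ =>
      exp (F.ρ τ θ) * F.Vτ τ θ - exp (F.ρ τ θ + 2*(F.V τ θ - τ)) * F.Qτ τ θ * F.Q τ θ)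
    (f' := fun τ θ => exp (F.ρ τ θ) * (F.ρτ τ θ * F.Vτ τ θ + F.Vττ τ θ)
      - (exp (F.ρ τ θ + 2*(F.V τ θ - τ))
          * ((F.ρτ τ θ + 2*(F.Vτ τ θ - 1)) * F.Qτ τ θ + F.Qττ τ θ) * F.Q τ θ
        + exp (F.ρ τ θ + 2*(F.V τ θ - τ)) * F.Qτ τ θ * F.Qτ τ θ))
    (by fun_prop) (by fun_prop) (fun τ θ => ?_) τ
  · have hA : F.A = fun τ => ∫ θ in (0:ℝ)..1, (exp (F.ρ τ θ) * F.Vτ τ θ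
        - exp (F.ρ τ θ + 2*(F.V τ θ - τ)) * F.Qτ τ θ * F.Q τ θ) := by
      ext t
      refine intervalIntegral.integral_congr fun θ _ => ?_
      simp only [exp_add]; ring
    rw [hA]
    refine h.congr_deriv ?_
    refine Eq.trans ?_ (integral_unit_deriv_periodic
      (w := fun x => exp (2*τ - F.ρ τ x) * F.Vθ τ x
        - exp (-F.ρ τ x + 2*F.V τ x) * F.Qθ τ x * F.Q τ x)
      (w' := fun θ => exp (2*τ - F.ρ τ θ) * (F.Vθθ τ θ - F.ρθ τ θ * F.Vθ τ θ)
        - (exp (-F.ρ τ θ + 2*F.V τ θ) * ((-F.ρθ τ θ + 2*F.Vθ τ θ) * F.Qθ τ θ + F.Qθθ τ θ)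
            * F.Q τ θ
          + exp (-F.ρ τ θ + 2*F.V τ θ) * F.Qθ τ θ * F.Qθ τ θ))
      (fun x => by simp only [F.periodic_ρ τ x, F.periodic_Vθ τ x, F.periodic_V τ x,
        F.periodic_Q τ x, F.periodic_Qθ τ x])
      (fun θ => ((((F.hasDerivAt_ρ_snd τ θ).const_sub (2*τ)).exp.fun_mul
        (F.hasDerivAt_Vθ_snd τ θ)).fun_sub
        ((((F.hasDerivAt_ρ_snd τ θ).fun_neg.fun_add
          ((F.hasDerivAt_V_snd τ θ).const_mul 2)).exp.fun_mul
          (F.hasDerivAt_Qθ_snd τ θ)).fun_mul (F.hasDerivAt_Q_snd τ θ))).congr_deriv (by ring))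
      (by fun_prop))
    refine intervalIntegral.integral_congr fun θ _ => ?_
    simp only [hF.V_evolution, hF.Q_evolution]
    simp only [exp_add, exp_sub, exp_neg, exp_two_mul']
    field_simp
    ring
  exact (((F.hasDerivAt_ρ_fst τ θ).exp.fun_mul (F.hasDerivAt_Vτ_fst τ θ)).fun_sub
    ((((F.hasDerivAt_ρ_fst τ θ).fun_add
      (((F.hasDerivAt_V_fst τ θ).fun_sub (hasDerivAt_id' τ)).const_mul 2)).exp.fun_mul
      (F.hasDerivAt_Qτ_fst τ θ)).fun_mul (F.hasDerivAt_Q_fst τ θ))).congr_deriv (by ring)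

lemma IsEinsteinFlow.A_eq (s t : ℝ) : F.A s = F.A t :=
  is_const_of_deriv_eq_zero (fun τ => (hF.hasDerivAt_A τ).differentiableAt)
    (fun τ => (hF.hasDerivAt_A τ).deriv) s t

lemma IsEinsteinFlow.hasDerivAt_E :
    HasDerivAt F.E (-(∫ θ in (0:ℝ)..1, exp (F.l τ θ) * F.eDens τ θ)
      - ∫ θ in (0:ℝ)..1, (F.kinV τ θ + F.gradQ τ θ)) τ := by
  have h := hasDerivAt_integral_unit (f := fun τ θ =>
      (1/2) * (exp (F.ρ τ θ - 2*τ) * F.Vτ τ θ ^ 2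
        + exp (F.ρ τ θ - 2*τ + 2*(F.V τ θ - τ)) * F.Qτ τ θ ^ 2
        + exp (-F.ρ τ θ) * F.Vθ τ θ ^ 2
        + exp (-F.ρ τ θ + 2*(F.V τ θ - τ)) * F.Qθ τ θ ^ 2))
    (f' := fun τ θ => (1/2) * (
      exp (F.ρ τ θ - 2*τ) * ((F.ρτ τ θ - 2) * F.Vτ τ θ ^ 2 + 2 * F.Vτ τ θ * F.Vττ τ θ)
      + exp (F.ρ τ θ - 2*τ + 2*(F.V τ θ - τ))
        * ((F.ρτ τ θ - 2 + 2*(F.Vτ τ θ - 1)) * F.Qτ τ θ ^ 2 + 2 * F.Qτ τ θ * F.Qττ τ θ)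
      + exp (-F.ρ τ θ) * (-F.ρτ τ θ * F.Vθ τ θ ^ 2 + 2 * F.Vθ τ θ * F.Vτθ τ θ)
      + exp (-F.ρ τ θ + 2*(F.V τ θ - τ))
        * ((-F.ρτ τ θ + 2*(F.Vτ τ θ - 1)) * F.Qθ τ θ ^ 2 + 2 * F.Qθ τ θ * F.Qτθ τ θ)))
    (by fun_prop) (by fun_prop) (fun τ θ => ?_) τ
  · have hE : F.E = fun τ => ∫ θ in (0:ℝ)..1,
      (1/2) * (exp (F.ρ τ θ - 2*τ) * F.Vτ τ θ ^ 2
        + exp (F.ρ τ θ - 2*τ + 2*(F.V τ θ - τ)) * F.Qτ τ θ ^ 2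
        + exp (-F.ρ τ θ) * F.Vθ τ θ ^ 2
        + exp (-F.ρ τ θ + 2*(F.V τ θ - τ)) * F.Qθ τ θ ^ 2) := by
      ext t
      exact intervalIntegral.integral_congr fun θ _ => eDens_eq t θ
    rw [hE]
    refine h.congr_deriv ?_
    have hw := integral_unit_deriv_periodic
      (w := fun x => exp (-F.ρ τ x) * F.Vθ τ x * F.Vτ τ x
        + exp (-F.ρ τ x + 2*(F.V τ x - τ)) * F.Qθ τ x * F.Qτ τ x)
      (w' := fun θ => exp (-F.ρ τ θ) * ((F.Vθθ τ θ - F.ρθ τ θ * F.Vθ τ θ) * F.Vτ τ θ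
            + F.Vθ τ θ * F.Vτθ τ θ)
        + exp (-F.ρ τ θ + 2*(F.V τ θ - τ))
          * (((-F.ρθ τ θ + 2*F.Vθ τ θ) * F.Qθ τ θ + F.Qθθ τ θ) * F.Qτ τ θ
            + F.Qθ τ θ * F.Qτθ τ θ))
      (fun x => by simp only [F.periodic_ρ τ x, F.periodic_Vθ τ x, F.periodic_V τ x,
        F.periodic_Vτ τ x, F.periodic_Qτ τ x, F.periodic_Qθ τ x])
      (fun θ => ((((F.hasDerivAt_ρ_snd τ θ).fun_neg.exp.fun_mul
        (F.hasDerivAt_Vθ_snd τ θ)).fun_mul (F.hasDerivAt_Vτ_snd τ θ)).fun_add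
        ((((F.hasDerivAt_ρ_snd τ θ).fun_neg.fun_add
          (((F.hasDerivAt_V_snd τ θ).sub_const τ).const_mul 2)).exp.fun_mul
          (F.hasDerivAt_Qθ_snd τ θ)).fun_mul (F.hasDerivAt_Qτ_snd τ θ))).congr_deriv (by ring))
      (by fun_prop)
    rw [← sub_eq_zero, sub_sub_eq_add_sub, sub_neg_eq_add,
      ← integral_unit_add (by fun_prop) (by fun_prop),
      ← integral_unit_add (by fun_prop) (by fun_prop)]
    refine Eq.trans ?_ hw
    refine intervalIntegral.integral_congr fun θ _ => ?_
    have hV := hF.V_evolution τ θ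
    have hQ := hF.Q_evolution τ θ
    have hl := hF.2.2.2.1 τ θ
    simp only [eDens_eq, kinV, kinQ, gradV, gradQ, ← hl]
    simp only [exp_add, exp_sub, exp_neg, exp_two_mul'] at hV hQ ⊢
    have ht := exp_pos τ
    have ha := exp_pos (F.ρ τ θ)
    have hv := exp_pos (F.V τ θ)
    generalize exp τ = t at *
    generalize exp (F.ρ τ θ) = a at *
    generalize exp (F.V τ θ) = v at *
    have e1 : F.Vττ τ θ = ((t ^ 2 / a * (F.Vθθ τ θ - F.ρθ τ θ * F.Vθ τ θ)
        + (v / t) ^ 2 * a * (F.Qτ τ θ ^ 2 - (t / a) ^ 2 * F.Qθ τ θ ^ 2)) / a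
        - F.ρτ τ θ * F.Vτ τ θ) := by
      rw [← hV]; field_simp; ring
    have e2 : F.Qττ τ θ = (a⁻¹ * v ^ 2 * ((-F.ρθ τ θ + 2*F.Vθ τ θ) * F.Qθ τ θ + F.Qθθ τ θ))
        / (a * (v / t) ^ 2) - (F.ρτ τ θ + 2*(F.Vτ τ θ - 1)) * F.Qτ τ θ := by
      rw [← hQ]; field_simp; ring
    rw [e1, e2]
    field_simp
    ring
  exact (((((((F.hasDerivAt_ρ_fst τ θ).fun_sub ((hasDerivAt_id' τ).const_mul 2)).exp.fun_mul
      ((F.hasDerivAt_Vτ_fst τ θ).fun_pow 2)).fun_add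
    ((((F.hasDerivAt_ρ_fst τ θ).fun_sub ((hasDerivAt_id' τ).const_mul 2)).fun_add
      (((F.hasDerivAt_V_fst τ θ).fun_sub (hasDerivAt_id' τ)).const_mul 2)).exp.fun_mul
      ((F.hasDerivAt_Qτ_fst τ θ).fun_pow 2))).fun_add
    ((F.hasDerivAt_ρ_fst τ θ).fun_neg.exp.fun_mul ((F.hasDerivAt_Vθ_fst τ θ).fun_pow 2))).fun_add
    (((F.hasDerivAt_ρ_fst τ θ).fun_neg.fun_add
      (((F.hasDerivAt_V_fst τ θ).fun_sub (hasDerivAt_id' τ)).const_mul 2)).exp.fun_mul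
      ((F.hasDerivAt_Qθ_fst τ θ).fun_pow 2))).const_mul (1/2)).congr_deriv (by push_cast; ring)

end IntegralDerivatives

end T2Flow

lemma abs_le_half_add {s : ℝ} (hs : 0 < s) (v : ℝ) : |v| ≤ (1/2) * (s + s⁻¹ * v ^ 2) := by
  have h1 : (1/2) * (s + s⁻¹ * v ^ 2) - |v| = (1/2) * s⁻¹ * (s - |v|) ^ 2 := by
    rw [← sq_abs v]; field_simp; ring
  have h2 : 0 ≤ (1/2) * s⁻¹ * (s - |v|) ^ 2 := by positivity
  linarith

/-- A weighted mean of a function differs from each value by at most the oscillation. -/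
lemma abs_sub_weighted_mean_le {f a : ℝ → ℝ} (hf : Continuous f) (ha : Continuous a)
    (ha0 : ∀ θ, 0 < a θ) {D x : ℝ} (hD : ∀ y ∈ Set.Icc (0:ℝ) 1, |x - f y| ≤ D) :
    |x - (∫ θ in (0:ℝ)..1, a θ * f θ) / ∫ θ in (0:ℝ)..1, a θ| ≤ D := by
  have hpos : 0 < ∫ θ in (0:ℝ)..1, a θ :=
    intervalIntegral.intervalIntegral_pos_of_pos (ha.intervalIntegrable _ _) ha0 zero_lt_one
  have h : |∫ θ in (0:ℝ)..1, a θ * (x - f θ)| ≤ ∫ θ in (0:ℝ)..1, D * a θ := by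
    refine abs_integral_unit_le (by fun_prop) (by fun_prop) fun θ hθ => ?_
    rw [abs_mul, abs_of_pos (ha0 θ), mul_comm]
    exact mul_le_mul_of_nonneg_right (hD θ hθ) (ha0 θ).le
  have e : ∫ θ in (0:ℝ)..1, a θ * (x - f θ)
      = x * (∫ θ in (0:ℝ)..1, a θ) - ∫ θ in (0:ℝ)..1, a θ * f θ := by
    rw [← intervalIntegral.integral_const_mul,
      ← integral_unit_sub (by fun_prop) (by fun_prop)]
    refine intervalIntegral.integral_congr fun θ _ => ?_
    ring
  rw [e, intervalIntegral.integral_const_mul] at h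
  have e2 : x - (∫ θ in (0:ℝ)..1, a θ * f θ) / ∫ θ in (0:ℝ)..1, a θ
      = (x * (∫ θ in (0:ℝ)..1, a θ) - ∫ θ in (0:ℝ)..1, a θ * f θ) / ∫ θ in (0:ℝ)..1, a θ := by
    field_simp
  rw [e2, abs_div, abs_of_pos hpos, div_le_iff₀ hpos]
  exact h

namespace T2Flow

/-- Quantitative control of a flow at time `τ`, where `z = e^{-τ/2}`. -/
structure Controlled (F : T2Flow) (τ z : ℝ) : Prop where
  flow : F.IsEinsteinFlow
  z_pos : 0 < z
  z_exp : z ^ 2 * exp τ = 1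
  z_small : z ≤ 1 / 10 ^ 20
  le_Pi : 2 / 5 ≤ F.Pi τ * z
  Pi_le : F.Pi τ * z ≤ 3 / 2
  E_le : F.E τ ≤ 50 * z ^ 3
  Y_le : F.Y τ * z ^ 5 ≤ 3 / 4
  abs_A : |F.A τ| ≤ 1
  B_zero : F.B τ = 0

lemma Pi_pos (F : T2Flow) (τ : ℝ) : 0 < F.Pi τ :=
  intervalIntegral.intervalIntegral_pos_of_pos
    (Continuous.intervalIntegrable (by fun_prop) _ _) (fun θ => exp_pos _) zero_lt_one

lemma E_nonneg (F : T2Flow) (τ : ℝ) : 0 ≤ F.E τ := integral_unit_nonneg (F.eDens_nonneg τ)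

/-- The weighted mean of `e^l`. -/
def lapse (F : T2Flow) (τ : ℝ) : ℝ :=
  (∫ θ in (0:ℝ)..1, exp (F.l τ θ) * exp (F.ρ τ θ)) / F.Pi τ

/-- The correction `Λ` with the mean of `V` replaced by the mean weighted by `e^ρ`. -/
def corr (F : T2Flow) (τ : ℝ) : ℝ :=
  (1/2) * exp (-2*τ) * (F.R τ - F.P τ * (F.S τ / F.Pi τ) - F.P τ)

lemma lapse_eq (F : T2Flow) (τ : ℝ) : F.lapse τ * (F.Pi τ * exp (2*τ)) = F.Y τ := by
  have := (F.Pi_pos τ).ne'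
  rw [lapse, Y, div_mul_eq_mul_div, mul_comm (F.Pi τ), ← mul_assoc, mul_div_cancel_right₀ _ this,
    mul_comm, ← intervalIntegral.integral_const_mul]
  refine intervalIntegral.integral_congr fun θ _ => ?_
  simp only [exp_add]; ring

namespace Controlled

variable {F : T2Flow} {τ z : ℝ} (h : F.Controlled τ z)
include h

lemma exp_eq : exp τ = (z ^ 2)⁻¹ := eq_inv_of_mul_eq_one_right h.z_exp

lemma exp_two_eq : exp (2*τ) = (z ^ 4)⁻¹ := by
  rw [exp_two_mul', h.exp_eq]; field_simp [h.z_pos.ne']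

lemma exp_neg_two_eq : exp (-2*τ) = z ^ 4 := by
  rw [neg_mul, exp_neg, h.exp_two_eq, inv_inv]

omit h in
lemma integral_density_le {u : ℝ → ℝ} (hu : Continuous u) (hle : ∀ θ, u θ ≤ 2 * F.eDens τ θ) :
    ∫ θ in (0:ℝ)..1, u θ ≤ 2 * F.E τ := by
  have := integral_unit_mono (v := fun θ => 2 * F.eDens τ θ) hu (by fun_prop) fun θ _ => hle θ
  rwa [intervalIntegral.integral_const_mul] at this

omit h in
lemma kinV_le (τ θ : ℝ) : F.kinV τ θ ≤ 2 * F.eDens τ θ := by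
  rw [eDens_eq]
  linarith [F.kinV_nonneg τ θ, F.kinQ_nonneg τ θ, F.gradV_nonneg τ θ, F.gradQ_nonneg τ θ]

omit h in
lemma kinQ_le (τ θ : ℝ) : F.kinQ τ θ ≤ 2 * F.eDens τ θ := by
  rw [eDens_eq]
  linarith [F.kinV_nonneg τ θ, F.kinQ_nonneg τ θ, F.gradV_nonneg τ θ, F.gradQ_nonneg τ θ]

omit h in
lemma gradV_le (τ θ : ℝ) : F.gradV τ θ ≤ 2 * F.eDens τ θ := by
  rw [eDens_eq]
  linarith [F.kinV_nonneg τ θ, F.kinQ_nonneg τ θ, F.gradV_nonneg τ θ, F.gradQ_nonneg τ θ]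

omit h in
lemma gradQ_le (τ θ : ℝ) : F.gradQ τ θ ≤ 2 * F.eDens τ θ := by
  rw [eDens_eq]
  linarith [F.kinV_nonneg τ θ, F.kinQ_nonneg τ θ, F.gradV_nonneg τ θ, F.gradQ_nonneg τ θ]

/-- The basic weighted bound for a gradient density. -/
lemma integral_grad_weight_le {u : ℝ → ℝ} (hu : Continuous u)
    (hle : ∀ θ, u θ ≤ 2 * F.eDens τ θ) :
    ∫ θ in (0:ℝ)..1, (z ^ 2 * exp (F.ρ τ θ) + (z ^ 2)⁻¹ * u θ) ≤ 102 * z := by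
  have hz := h.z_pos
  rw [integral_unit_add (by fun_prop) (by fun_prop), intervalIntegral.integral_const_mul,
    intervalIntegral.integral_const_mul]
  change z ^ 2 * F.Pi τ + _ ≤ _
  have h1 := (integral_density_le hu hle).trans (mul_le_mul_of_nonneg_left h.E_le zero_le_two)
  have h2 : (z ^ 2)⁻¹ * ∫ θ in (0:ℝ)..1, u θ ≤ (z ^ 2)⁻¹ * (2 * (50 * z ^ 3)) :=
    mul_le_mul_of_nonneg_left h1 (by positivity)
  have h3 : (z ^ 2)⁻¹ * (2 * (50 * z ^ 3)) = 100 * z := by field_simp; norm_num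
  nlinarith [h.Pi_le]

/-- The basic weighted bound for a kinetic density. -/
lemma integral_kin_weight_le {u : ℝ → ℝ} (hu : Continuous u)
    (hle : ∀ θ, u θ ≤ 2 * F.eDens τ θ) :
    ∫ θ in (0:ℝ)..1, (exp (F.ρ τ θ) + (z ^ 4)⁻¹ * u θ) ≤ 102 * z⁻¹ := by
  have hz := h.z_pos
  rw [integral_unit_add (by fun_prop) (by fun_prop), intervalIntegral.integral_const_mul]
  change F.Pi τ + _ ≤ _
  have h1 := (integral_density_le hu hle).trans (mul_le_mul_of_nonneg_left h.E_le zero_le_two)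
  have h2 : (z ^ 4)⁻¹ * ∫ θ in (0:ℝ)..1, u θ ≤ (z ^ 4)⁻¹ * (2 * (50 * z ^ 3)) :=
    mul_le_mul_of_nonneg_left h1 (by positivity)
  have h3 : (z ^ 4)⁻¹ * (2 * (50 * z ^ 3)) = 100 * z⁻¹ := by field_simp; norm_num
  have h4 : F.Pi τ ≤ 3 / 2 * z⁻¹ := by
    rw [← div_eq_mul_inv, le_div_iff₀ hz]; exact h.Pi_le
  have : 0 < z⁻¹ := by positivity
  linarith

lemma abs_V_sub_le {x y : ℝ} (hx : x ∈ Set.Icc (0:ℝ) 1) (hy : y ∈ Set.Icc (0:ℝ) 1) :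
    |F.V τ x - F.V τ y| ≤ 51 * z := by
  have hz := h.z_pos
  have key := abs_sub_le_integral_unit (w := F.V τ) (w' := F.Vθ τ)
    (v := fun θ => (1/2) * (z ^ 2 * exp (F.ρ τ θ) + (z ^ 2)⁻¹ * F.gradV τ θ))
    (F.hasDerivAt_V_snd τ) (by fun_prop) (by fun_prop) (fun θ => ?_) hx hy
  · rw [intervalIntegral.integral_const_mul] at key
    linarith [h.integral_grad_weight_le (u := F.gradV τ) (by fun_prop) (gradV_le τ)]
  refine (abs_le_half_add (s := z ^ 2 * exp (F.ρ τ θ)) (by positivity) _).trans_eq ?_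
  rw [gradV, exp_neg, mul_inv, mul_assoc]

lemma abs_l_sub_le {x y : ℝ} (hx : x ∈ Set.Icc (0:ℝ) 1) (hy : y ∈ Set.Icc (0:ℝ) 1) :
    |F.l τ x - F.l τ y| ≤ 51 * z := by
  have hz := h.z_pos
  have key := abs_sub_le_integral_unit (w := F.l τ) (w' := F.lθ τ)
    (v := fun θ => exp τ * F.eDens τ θ)
    (F.hasDerivAt_l_snd τ) (by fun_prop) (by fun_prop) (fun θ => ?_) hx hy
  · rw [intervalIntegral.integral_const_mul, h.exp_eq] at key
    have h2 : (z ^ 2)⁻¹ * F.E τ ≤ (z ^ 2)⁻¹ * (50 * z ^ 3) :=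
      mul_le_mul_of_nonneg_left h.E_le (by positivity)
    have h3 : (z ^ 2)⁻¹ * (50 * z ^ 3) = 50 * z := by field_simp
    change _ ≤ (z ^ 2)⁻¹ * F.E τ at key
    linarith
  rw [h.flow.2.2.2.2, eDens_eq]
  have e1 : 0 ≤ exp τ * (F.kinV τ θ + F.gradV τ θ) - 2 * |F.Vθ τ θ * F.Vτ τ θ| := by
    have : exp τ * (F.kinV τ θ + F.gradV τ θ) - 2 * |F.Vθ τ θ * F.Vτ τ θ|
        = (exp (F.ρ τ θ) * exp τ)⁻¹ * (exp (F.ρ τ θ) * |F.Vτ τ θ| - exp τ * |F.Vθ τ θ|) ^ 2 := by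
      simp only [kinV, gradV, exp_sub, exp_neg, exp_two_mul', abs_mul]
      rw [← sq_abs (F.Vτ τ θ), ← sq_abs (F.Vθ τ θ)]
      field_simp
      ring
    rw [this]; positivity
  have e2 : 0 ≤ exp τ * (F.kinQ τ θ + F.gradQ τ θ)
      - 2 * |exp (2*(F.V τ θ - τ)) * F.Qθ τ θ * F.Qτ τ θ| := by
    have : exp τ * (F.kinQ τ θ + F.gradQ τ θ)
        - 2 * |exp (2*(F.V τ θ - τ)) * F.Qθ τ θ * F.Qτ τ θ|
        = exp (2*(F.V τ θ - τ)) * (exp (F.ρ τ θ) * exp τ)⁻¹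
          * (exp (F.ρ τ θ) * |F.Qτ τ θ| - exp τ * |F.Qθ τ θ|) ^ 2 := by
      simp only [abs_mul, abs_exp, kinQ, gradQ]
      simp only [exp_add, exp_sub, exp_neg, exp_two_mul']
      rw [← sq_abs (F.Qτ τ θ), ← sq_abs (F.Qθ τ θ)]
      field_simp
      ring
    rw [this]; positivity
  have := abs_add_le (F.Vθ τ θ * F.Vτ τ θ) (exp (2*(F.V τ θ - τ)) * F.Qθ τ θ * F.Qτ τ θ)
  linarith

omit h in
lemma lapse_nonneg : 0 ≤ F.lapse τ :=
  div_nonneg (integral_unit_nonneg fun θ => by positivity) (F.Pi_pos τ).le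

lemma lapse_le : F.lapse τ ≤ 2 := by
  have hz := h.z_pos
  have h1 := F.lapse_eq τ
  rw [h.exp_two_eq] at h1
  have h2 : F.lapse τ * (F.Pi τ * z) = F.Y τ * z ^ 5 := by
    rw [← h1]; field_simp
  nlinarith [h.le_Pi, h.Y_le, lapse_nonneg (F := F) (τ := τ)]

lemma abs_exp_l_sub_le {θ : ℝ} (hθ : θ ∈ Set.Icc (0:ℝ) 1) :
    |exp (F.l τ θ) - F.lapse τ| ≤ 204 * z := by
  have hz := h.z_pos
  have hzs := h.z_small
  have hL : exp (51 * z) ≤ 1 + 102 * z := by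
    have := abs_exp_sub_one_le (x := 51 * z) (by rw [abs_of_pos (by positivity)]; linarith)
    rw [abs_of_pos (show 0 < 51 * z by positivity)] at this
    linarith [(abs_le.1 this).2]
  have hcmp : ∀ x ∈ Set.Icc (0:ℝ) 1, ∀ y ∈ Set.Icc (0:ℝ) 1,
      exp (F.l τ x) ≤ (1 + 102 * z) * exp (F.l τ y) := by
    intro x hx y hy
    have := (abs_le.1 (h.abs_l_sub_le hx hy)).2
    calc exp (F.l τ x) ≤ exp (51 * z + F.l τ y) := exp_le_exp.2 (by linarith)
      _ = exp (51 * z) * exp (F.l τ y) := exp_add _ _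
      _ ≤ _ := mul_le_mul_of_nonneg_right hL (exp_pos _).le
  have hm : F.lapse τ * F.Pi τ = ∫ θ in (0:ℝ)..1, exp (F.l τ θ) * exp (F.ρ τ θ) :=
    div_mul_cancel₀ _ (F.Pi_pos τ).ne'
  have u1 : exp (F.l τ θ) * F.Pi τ ≤ (1 + 102 * z) * (F.lapse τ * F.Pi τ) := by
    rw [hm, Pi, ← intervalIntegral.integral_const_mul, ← intervalIntegral.integral_const_mul]
    refine integral_unit_mono (by fun_prop) (by fun_prop) fun y hy => ?_
    rw [← mul_assoc]
    exact mul_le_mul_of_nonneg_right (hcmp θ hθ y hy) (exp_pos _).le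
  have u2 : F.lapse τ * F.Pi τ ≤ (1 + 102 * z) * exp (F.l τ θ) * F.Pi τ := by
    rw [hm, Pi, ← intervalIntegral.integral_const_mul]
    refine integral_unit_mono (by fun_prop) (by fun_prop) fun y hy => ?_
    exact mul_le_mul_of_nonneg_right (hcmp y hy θ hθ) (exp_pos _).le
  have v1 : exp (F.l τ θ) ≤ (1 + 102 * z) * F.lapse τ :=
    le_of_mul_le_mul_right (by linarith) (F.Pi_pos τ)
  have v2 : F.lapse τ ≤ (1 + 102 * z) * exp (F.l τ θ) :=
    le_of_mul_le_mul_right u2 (F.Pi_pos τ)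
  have hle := h.lapse_le
  have h0 := lapse_nonneg (F := F) (τ := τ)
  have hp := exp_pos (F.l τ θ)
  rw [abs_le]
  constructor
  · by_cases hc : exp (F.l τ θ) ≤ 2
    · nlinarith
    · nlinarith
  · nlinarith

end Controlled

end T2Flow

namespace T2Flow.Controlled

variable {F : T2Flow} {τ z : ℝ} (h : F.Controlled τ z)
include h

lemma exp_V_le (x y : ℝ) : exp (F.V τ x - τ) ≤ 2 * exp (F.V τ y - τ) := by
  have hz := h.z_pos
  have hzs := h.z_small
  have hL : exp (51 * z) ≤ 2 := by
    have := abs_exp_sub_one_le (x := 51 * z) (by rw [abs_of_pos (by positivity)]; linarith)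
    rw [abs_of_pos (show 0 < 51 * z by positivity)] at this
    linarith [(abs_le.1 this).2]
  obtain ⟨x', hx', ex⟩ := (F.periodic_V τ).exists_mem_Ico₀ zero_lt_one x
  obtain ⟨y', hy', ey⟩ := (F.periodic_V τ).exists_mem_Ico₀ zero_lt_one y
  have := (abs_le.1 (h.abs_V_sub_le (Set.Ico_subset_Icc_self hx')
    (Set.Ico_subset_Icc_self hy'))).2
  rw [ex, ey]
  calc exp (F.V τ x' - τ) ≤ exp (51 * z + (F.V τ y' - τ)) := exp_le_exp.2 (by linarith)
    _ = exp (51 * z) * exp (F.V τ y' - τ) := exp_add _ _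
    _ ≤ _ := mul_le_mul_of_nonneg_right hL (exp_pos _).le

/-- The total `V`-momentum is bounded, by conservation of `A` and `B = 0`. -/
lemma abs_P_le : |F.P τ| ≤ 10405 := by
  have hz := h.z_pos
  set y : ℝ := exp (F.V τ 0 - τ) with hy
  have hy0 : 0 < y := exp_pos _
  have hQ : ∀ x ∈ Set.Icc (0:ℝ) 1, |F.Q τ x - F.Q τ 0| ≤ y⁻¹ * (102 * z) := by
    intro x hx
    have key := abs_sub_le_integral_unit (w := F.Q τ) (w' := F.Qθ τ)
      (v := fun θ => y⁻¹ * (z ^ 2 * exp (F.ρ τ θ) + (z ^ 2)⁻¹ * F.gradQ τ θ))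
      (F.hasDerivAt_Q_snd τ) (by fun_prop) (by fun_prop) (fun θ => ?_) hx ⟨le_rfl, zero_le_one⟩
    · rw [intervalIntegral.integral_const_mul] at key
      exact key.trans (mul_le_mul_of_nonneg_left
        (h.integral_grad_weight_le (u := F.gradQ τ) (by fun_prop) (gradQ_le τ)) (by positivity))
    have e := abs_le_half_add (s := z ^ 2 * exp (F.ρ τ θ)) (by positivity)
      (exp (F.V τ θ - τ) * F.Qθ τ θ)
    have e1 : (z ^ 2 * exp (F.ρ τ θ))⁻¹ * (exp (F.V τ θ - τ) * F.Qθ τ θ) ^ 2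
        = (z ^ 2)⁻¹ * F.gradQ τ θ := by
      simp only [gradQ, exp_add, exp_neg, exp_two_mul']; field_simp
    rw [e1, abs_mul, abs_exp] at e
    have e2 := mul_le_mul_of_nonneg_right (h.exp_V_le 0 θ) (abs_nonneg (F.Qθ τ θ))
    rw [inv_mul_eq_div, le_div_iff₀ hy0]
    rw [← hy] at e2
    linarith
  have hP : F.P τ = F.A τ
      + ∫ θ in (0:ℝ)..1, exp (F.ρ τ θ + 2*(F.V τ θ - τ)) * F.Qτ τ θ * (F.Q τ θ - F.Q τ 0) := by
    have hB : F.P τ - F.Q τ 0 * F.B τ = F.A τ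
        + ∫ θ in (0:ℝ)..1, exp (F.ρ τ θ + 2*(F.V τ θ - τ)) * F.Qτ τ θ
          * (F.Q τ θ - F.Q τ 0) := by
      rw [B, ← intervalIntegral.integral_const_mul, P, A,
        ← integral_unit_sub (by fun_prop) (by fun_prop),
        ← integral_unit_add (by fun_prop) (by fun_prop)]
      refine intervalIntegral.integral_congr fun θ _ => ?_
      simp only [exp_add]; ring
    rwa [h.B_zero, mul_zero, sub_zero] at hB
  have hI : |∫ θ in (0:ℝ)..1, exp (F.ρ τ θ + 2*(F.V τ θ - τ)) * F.Qτ τ θ * (F.Q τ θ - F.Q τ 0)|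
      ≤ ∫ θ in (0:ℝ)..1, (102 * z) * (exp (F.ρ τ θ) + (z ^ 4)⁻¹ * F.kinQ τ θ) := by
    refine abs_integral_unit_le (by fun_prop) (by fun_prop) fun θ hθ => ?_
    have e := abs_le_half_add (s := exp (F.ρ τ θ)) (by positivity)
      (exp (F.ρ τ θ) * exp (F.V τ θ - τ) * F.Qτ τ θ)
    have e1 : (exp (F.ρ τ θ))⁻¹ * (exp (F.ρ τ θ) * exp (F.V τ θ - τ) * F.Qτ τ θ) ^ 2
        = (z ^ 4)⁻¹ * F.kinQ τ θ := by
      rw [← h.exp_two_eq]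
      simp only [kinQ, exp_add, exp_sub (F.ρ τ θ), exp_two_mul']; field_simp
    rw [e1] at e
    have e3 : |exp (F.ρ τ θ + 2*(F.V τ θ - τ)) * F.Qτ τ θ|
        ≤ y * (exp (F.ρ τ θ) + (z ^ 4)⁻¹ * F.kinQ τ θ) := by
      have : exp (F.ρ τ θ + 2*(F.V τ θ - τ)) * F.Qτ τ θ
          = exp (F.V τ θ - τ) * (exp (F.ρ τ θ) * exp (F.V τ θ - τ) * F.Qτ τ θ) := by
        simp only [exp_add, exp_two_mul']; ring
      rw [this, abs_mul, abs_exp]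
      calc _ ≤ (2 * y) * _ := mul_le_mul (h.exp_V_le θ 0) e (abs_nonneg _) (by positivity)
        _ = _ := by ring
    rw [abs_mul]
    calc _ ≤ (y * (exp (F.ρ τ θ) + (z ^ 4)⁻¹ * F.kinQ τ θ)) * (y⁻¹ * (102 * z)) :=
          mul_le_mul e3 (hQ θ hθ) (abs_nonneg _) ((abs_nonneg _).trans e3)
      _ = _ := by field_simp
  rw [intervalIntegral.integral_const_mul] at hI
  have hK := mul_le_mul_of_nonneg_left
    (h.integral_kin_weight_le (u := F.kinQ τ) (by fun_prop) (kinQ_le τ))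
    (show 0 ≤ 102 * z by positivity)
  have e4 : 102 * z * (102 * z⁻¹) = 10404 := by field_simp; norm_num
  rw [hP]
  have := abs_add_le (F.A τ) (∫ θ in (0:ℝ)..1,
    exp (F.ρ τ θ + 2*(F.V τ θ - τ)) * F.Qτ τ θ * (F.Q τ θ - F.Q τ 0))
  linarith [h.abs_A]

/-- The mean of `V` weighted by `e^ρ`. -/
lemma abs_V_sub_mean_le {θ : ℝ} (hθ : θ ∈ Set.Icc (0:ℝ) 1) :
    |F.V τ θ - F.S τ / F.Pi τ| ≤ 51 * z :=
  abs_sub_weighted_mean_le (f := F.V τ) (a := fun θ => exp (F.ρ τ θ)) (by fun_prop) (by fun_prop)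
    (fun _ => exp_pos _) fun _ hy => h.abs_V_sub_le hθ hy

lemma abs_circleMean_sub_le : |circleMean (F.V τ) - F.S τ / F.Pi τ| ≤ 51 * z := by
  have : circleMean (F.V τ) - F.S τ / F.Pi τ
      = ∫ θ in (0:ℝ)..1, (F.V τ θ - F.S τ / F.Pi τ) := by
    rw [integral_unit_sub (by fun_prop) (by fun_prop)]
    simp [circleMean]
  rw [this]
  refine (abs_integral_unit_le (v := fun _ => 51 * z) (by fun_prop) (by fun_prop)
    fun θ hθ => h.abs_V_sub_mean_le hθ).trans_eq ?_
  simp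

/-- A `e^ρ V_τ`-weighted integral of a bounded function. -/
lemma abs_integral_momentum_le {f : ℝ → ℝ} (hf : Continuous f) {D : ℝ}
    (hD : ∀ θ ∈ Set.Icc (0:ℝ) 1, |f θ| ≤ D) :
    |∫ θ in (0:ℝ)..1, exp (F.ρ τ θ) * F.Vτ τ θ * f θ| ≤ D * (51 * z⁻¹) := by
  have hD0 : 0 ≤ D := (abs_nonneg _).trans (hD 0 ⟨le_rfl, zero_le_one⟩)
  have hI : |∫ θ in (0:ℝ)..1, exp (F.ρ τ θ) * F.Vτ τ θ * f θ|
      ≤ ∫ θ in (0:ℝ)..1, (D / 2) * (exp (F.ρ τ θ) + (z ^ 4)⁻¹ * F.kinV τ θ) := by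
    refine abs_integral_unit_le (by fun_prop) (by fun_prop) fun θ hθ => ?_
    have e := abs_le_half_add (s := exp (F.ρ τ θ)) (by positivity) (exp (F.ρ τ θ) * F.Vτ τ θ)
    have e1 : (exp (F.ρ τ θ))⁻¹ * (exp (F.ρ τ θ) * F.Vτ τ θ) ^ 2 = (z ^ 4)⁻¹ * F.kinV τ θ := by
      rw [← h.exp_two_eq]
      simp only [kinV, exp_sub (F.ρ τ θ)]; field_simp
    rw [e1] at e
    rw [abs_mul]
    calc _ ≤ _ := mul_le_mul e (hD θ hθ) (abs_nonneg _) ((abs_nonneg _).trans e)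
      _ = _ := by ring
  rw [intervalIntegral.integral_const_mul] at hI
  have hK := mul_le_mul_of_nonneg_left
    (h.integral_kin_weight_le (u := F.kinV τ) (by fun_prop) (kinV_le τ))
    (show 0 ≤ D / 2 by positivity)
  linarith

omit h in
lemma R_sub_eq : F.R τ - F.P τ * (F.S τ / F.Pi τ)
    = ∫ θ in (0:ℝ)..1, exp (F.ρ τ θ) * F.Vτ τ θ * (F.V τ θ - F.S τ / F.Pi τ) := by
  rw [R, P, ← intervalIntegral.integral_mul_const, ← integral_unit_sub (by fun_prop) (by fun_prop)]
  refine intervalIntegral.integral_congr fun θ _ => ?_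
  ring

lemma abs_corr_le : |F.corr τ| ≤ 6504 * z ^ 4 := by
  have hz := h.z_pos
  have h1 : |F.R τ - F.P τ * (F.S τ / F.Pi τ)| ≤ 2601 := by
    rw [R_sub_eq]
    refine (h.abs_integral_momentum_le (by fun_prop) fun θ hθ => h.abs_V_sub_mean_le hθ).trans_eq ?_
    field_simp; norm_num
  have h2 := h.abs_P_le
  rw [corr, h.exp_neg_two_eq, abs_mul, abs_of_pos (show 0 < 1 / 2 * z ^ 4 by positivity)]
  have h3 := abs_sub (F.R τ - F.P τ * (F.S τ / F.Pi τ)) (F.P τ)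
  have h4 := mul_le_mul_of_nonneg_left (h3.trans (add_le_add h1 h2))
    (show 0 ≤ 1 / 2 * z ^ 4 by positivity)
  refine h4.trans ?_
  nlinarith [show 0 < z ^ 4 by positivity]

end T2Flow.Controlled

lemma abs_integral_weighted_le {a f : ℝ → ℝ} (ha : Continuous a) (hf : Continuous f) {D : ℝ}
    (hD : ∀ θ ∈ Set.Icc (0:ℝ) 1, |f θ| ≤ D) (ha0 : ∀ θ, 0 ≤ a θ) :
    |∫ θ in (0:ℝ)..1, a θ * f θ| ≤ D * ∫ θ in (0:ℝ)..1, a θ := by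
  rw [← intervalIntegral.integral_const_mul]
  refine abs_integral_unit_le (by fun_prop) (by fun_prop) fun θ hθ => ?_
  rw [abs_mul, abs_of_nonneg (ha0 θ), mul_comm]
  exact mul_le_mul_of_nonneg_right (hD θ hθ) (ha0 θ)

namespace T2Flow

variable {F : T2Flow} {τ : ℝ}

lemma IsEinsteinFlow.hasDerivAt_meanV (hF : F.IsEinsteinFlow) :
    HasDerivAt (fun s => F.S s / F.Pi s)
      ((F.P τ + ∫ θ in (0:ℝ)..1, exp (F.l τ θ) * exp (F.ρ τ θ) * (F.V τ θ - F.S τ / F.Pi τ))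
        / F.Pi τ) τ := by
  have hp := (F.Pi_pos τ).ne'
  refine ((hF.hasDerivAt_S τ).fun_div (hF.hasDerivAt_Pi τ) hp).congr_deriv ?_
  have : ∫ θ in (0:ℝ)..1, exp (F.l τ θ) * exp (F.ρ τ θ) * (F.V τ θ - F.S τ / F.Pi τ)
      = (∫ θ in (0:ℝ)..1, exp (F.l τ θ) * exp (F.ρ τ θ) * F.V τ θ)
        - (∫ θ in (0:ℝ)..1, exp (F.l τ θ) * exp (F.ρ τ θ)) * (F.S τ / F.Pi τ) := by
    rw [← intervalIntegral.integral_mul_const,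
      ← integral_unit_sub (by fun_prop) (by fun_prop)]
    refine intervalIntegral.integral_congr fun θ _ => ?_
    ring
  rw [this]
  field_simp
  ring

/-- The logarithmically corrected energy `e^τ Π (E + corr)`, which is almost conserved. -/
def almostConserved (F : T2Flow) (τ : ℝ) : ℝ := exp τ * (F.Pi τ * (F.E τ + F.corr τ))

lemma IsEinsteinFlow.hasDerivAt_corr (hF : F.IsEinsteinFlow) {W : ℝ}
    (hW : HasDerivAt (fun s => F.S s / F.Pi s) W τ) :
    HasDerivAt F.corr (-2 * F.corr τ + (1/2) * ((∫ θ in (0:ℝ)..1, (F.kinV τ θ - F.gradV τ θ))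
      - (∫ θ in (0:ℝ)..1, (F.kinQ τ θ - F.gradQ τ θ))
      + ∫ θ in (0:ℝ)..1, (F.kinQ τ θ - F.gradQ τ θ) * (F.V τ θ - F.S τ / F.Pi τ))
      - (1/2) * exp (-2*τ) * (F.P τ * W)) τ := by
  have h1 : HasDerivAt (fun s : ℝ => (1/2) * exp (-2*s)) ((1/2) * (exp (-2*τ) * (-2*1))) τ :=
    (((hasDerivAt_id' τ).const_mul (-2)).exp).const_mul (1/2)
  refine (h1.fun_mul (((hF.hasDerivAt_R τ).fun_sub ((hF.hasDerivAt_P τ).fun_mul hW)).fun_sub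
    (hF.hasDerivAt_P τ))).congr_deriv ?_
  have : ∫ θ in (0:ℝ)..1, (F.kinQ τ θ - F.gradQ τ θ) * (F.V τ θ - F.S τ / F.Pi τ)
      = (∫ θ in (0:ℝ)..1, (F.kinQ τ θ - F.gradQ τ θ) * F.V τ θ)
        - (∫ θ in (0:ℝ)..1, (F.kinQ τ θ - F.gradQ τ θ)) * (F.S τ / F.Pi τ) := by
    rw [← intervalIntegral.integral_mul_const,
      ← integral_unit_sub (by fun_prop) (by fun_prop)]
    refine intervalIntegral.integral_congr fun θ _ => ?_
    ring
  have he : exp (-2*τ) * exp (2*τ) = 1 := by rw [← exp_add]; simp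
  rw [this, corr]
  linear_combination (1/2) * ((∫ θ in (0:ℝ)..1, (F.kinV τ θ - F.gradV τ θ))
    + (∫ θ in (0:ℝ)..1, (F.kinQ τ θ - F.gradQ τ θ) * F.V τ θ)
    - (∫ θ in (0:ℝ)..1, (F.kinQ τ θ - F.gradQ τ θ)) * (F.S τ / F.Pi τ)
    - (∫ θ in (0:ℝ)..1, (F.kinQ τ θ - F.gradQ τ θ))) * he

lemma IsEinsteinFlow.hasDerivAt_almostConserved (hF : F.IsEinsteinFlow) {W : ℝ}
    (hW : HasDerivAt (fun s => F.S s / F.Pi s) W τ) :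
    HasDerivAt F.almostConserved (exp τ * (F.Pi τ *
      ((F.lapse τ * F.E τ - ∫ θ in (0:ℝ)..1, exp (F.l τ θ) * F.eDens τ θ)
        + (F.lapse τ - 1) * F.corr τ
        + (1/2) * (∫ θ in (0:ℝ)..1, (F.kinQ τ θ - F.gradQ τ θ) * (F.V τ θ - F.S τ / F.Pi τ))
        - (1/2) * exp (-2*τ) * (F.P τ * W)))) τ := by
  refine ((hasDerivAt_exp τ).fun_mul ((hF.hasDerivAt_Pi τ).fun_mul
    ((hF.hasDerivAt_E τ).fun_add (hF.hasDerivAt_corr hW)))).congr_deriv ?_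
  have hm : ∫ θ in (0:ℝ)..1, exp (F.l τ θ) * exp (F.ρ τ θ) = F.lapse τ * F.Pi τ :=
    (div_mul_cancel₀ _ (F.Pi_pos τ).ne').symm
  have hE : F.E τ = (1/2) * ((∫ θ in (0:ℝ)..1, F.kinV τ θ) + (∫ θ in (0:ℝ)..1, F.kinQ τ θ)
      + (∫ θ in (0:ℝ)..1, F.gradV τ θ) + (∫ θ in (0:ℝ)..1, F.gradQ τ θ)) := by
    rw [← integral_unit_add (by fun_prop) (by fun_prop),
      ← integral_unit_add (by fun_prop) (by fun_prop),
      ← integral_unit_add (by fun_prop) (by fun_prop), ← intervalIntegral.integral_const_mul]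
    refine intervalIntegral.integral_congr fun θ _ => ?_
    have := F.eDens_eq τ θ
    rw [eDens] at this
    rw [this]
  rw [hm, integral_unit_sub (u := F.kinV τ) (by fun_prop) (by fun_prop),
    integral_unit_sub (u := F.kinQ τ) (by fun_prop) (by fun_prop),
    integral_unit_add (u := F.kinV τ) (by fun_prop) (by fun_prop)]
  linear_combination exp τ * F.Pi τ * hE

namespace Controlled

variable {z : ℝ} (h : F.Controlled τ z)
include h

lemma exp_mul_Pi_le : exp τ * F.Pi τ ≤ 3 / 2 * (z ^ 3)⁻¹ := by
  have hz := h.z_pos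
  rw [h.exp_eq, ← div_eq_mul_inv, le_div_iff₀ (by positivity)]
  have : (z ^ 2)⁻¹ * F.Pi τ * z ^ 3 = F.Pi τ * z := by field_simp
  rw [this]; exact h.Pi_le

lemma abs_exp_mul_Pi_mul_le {x K : ℝ} (hx : |x| ≤ K * z ^ 4) :
    |exp τ * (F.Pi τ * x)| ≤ 3 / 2 * K * z := by
  have hz := h.z_pos
  have hp := F.Pi_pos τ
  rw [← mul_assoc, abs_mul, abs_of_pos (mul_pos (exp_pos τ) hp)]
  refine (mul_le_mul h.exp_mul_Pi_le hx (abs_nonneg _) (by positivity)).trans_eq ?_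
  field_simp

/-- The lapse oscillates little against the energy density. -/
lemma abs_lapse_mul_E_sub_le :
    |F.lapse τ * F.E τ - ∫ θ in (0:ℝ)..1, exp (F.l τ θ) * F.eDens τ θ| ≤ 10200 * z ^ 4 := by
  have hz := h.z_pos
  have e : F.lapse τ * F.E τ - ∫ θ in (0:ℝ)..1, exp (F.l τ θ) * F.eDens τ θ
      = ∫ θ in (0:ℝ)..1, F.eDens τ θ * (F.lapse τ - exp (F.l τ θ)) := by
    rw [E, ← intervalIntegral.integral_const_mul]
    rw [← integral_unit_sub (by fun_prop) (by fun_prop)]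
    refine intervalIntegral.integral_congr fun θ _ => ?_
    simp only [eDens]; ring
  rw [e]
  have := abs_integral_weighted_le (a := F.eDens τ) (f := fun θ => F.lapse τ - exp (F.l τ θ))
    (by fun_prop) (by fun_prop) (D := 204 * z)
    (fun θ hθ => by rw [abs_sub_comm]; exact h.abs_exp_l_sub_le hθ) (F.eDens_nonneg τ)
  refine this.trans ?_
  have h2 := mul_le_mul_of_nonneg_left h.E_le (show 0 ≤ 204 * z by positivity)
  change 204 * z * F.E τ ≤ _
  linarith

lemma abs_meanV_deriv_le :
    |(F.P τ + ∫ θ in (0:ℝ)..1, exp (F.l τ θ) * exp (F.ρ τ θ) * (F.V τ θ - F.S τ / F.Pi τ))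
        / F.Pi τ| ≤ 30000 * z := by
  have hz := h.z_pos
  have hp := F.Pi_pos τ
  have h1 := abs_integral_weighted_le (a := fun θ => exp (F.l τ θ) * exp (F.ρ τ θ))
    (f := fun θ => F.V τ θ - F.S τ / F.Pi τ) (by fun_prop) (by fun_prop) (D := 51 * z)
    (fun θ hθ => h.abs_V_sub_mean_le hθ) (fun θ => by positivity)
  have hm : ∫ θ in (0:ℝ)..1, exp (F.l τ θ) * exp (F.ρ τ θ) = F.lapse τ * F.Pi τ :=
    (div_mul_cancel₀ _ (F.Pi_pos τ).ne').symm
  rw [hm] at h1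
  have h2 : 51 * z * (F.lapse τ * F.Pi τ) ≤ 51 * z * (2 * F.Pi τ) := by
    have := h.lapse_le
    gcongr
  rw [abs_div, abs_of_pos hp, div_le_iff₀ hp]
  have h3 := abs_add_le (F.P τ)
    (∫ θ in (0:ℝ)..1, exp (F.l τ θ) * exp (F.ρ τ θ) * (F.V τ θ - F.S τ / F.Pi τ))
  nlinarith [h.abs_P_le, h.le_Pi, mul_pos hz hp]

lemma exists_hasDerivAt_almostConserved :
    ∃ D, HasDerivAt F.almostConserved D τ ∧ |D| ≤ 10 ^ 6 * z := by
  have hz := h.z_pos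
  refine ⟨_, h.flow.hasDerivAt_almostConserved h.flow.hasDerivAt_meanV, ?_⟩
  set W := (F.P τ
    + ∫ θ in (0:ℝ)..1, exp (F.l τ θ) * exp (F.ρ τ θ) * (F.V τ θ - F.S τ / F.Pi τ)) / F.Pi τ
  have hW : |W| ≤ 30000 * z := h.abs_meanV_deriv_le
  refine (h.abs_exp_mul_Pi_mul_le (K := 30000) ?_).trans (by linarith)
  have h1 := abs_le.1 h.abs_lapse_mul_E_sub_le
  have h2 : |(F.lapse τ - 1) * F.corr τ| ≤ 1 * (6504 * z ^ 4) := by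
    rw [abs_mul]
    refine mul_le_mul (abs_le.2 ⟨?_, ?_⟩) h.abs_corr_le (abs_nonneg _) zero_le_one
    · linarith [lapse_nonneg (F := F) (τ := τ)]
    · linarith [h.lapse_le]
  have h3 : |∫ θ in (0:ℝ)..1, (F.kinQ τ θ - F.gradQ τ θ) * (F.V τ θ - F.S τ / F.Pi τ)|
      ≤ ∫ θ in (0:ℝ)..1, (2 * (51 * z)) * F.eDens τ θ := by
    refine abs_integral_unit_le (by fun_prop) (by fun_prop) fun θ hθ => ?_
    rw [abs_mul]
    have e : |F.kinQ τ θ - F.gradQ τ θ| ≤ 2 * F.eDens τ θ := by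
      rw [abs_le]
      constructor <;> linarith [kinQ_le (F := F) τ θ, gradQ_le (F := F) τ θ, F.kinQ_nonneg τ θ,
        F.gradQ_nonneg τ θ]
    refine (mul_le_mul e (h.abs_V_sub_mean_le hθ) (abs_nonneg _)
      ((abs_nonneg _).trans e)).trans_eq ?_
    ring
  rw [intervalIntegral.integral_const_mul] at h3
  have h3' := mul_le_mul_of_nonneg_left h.E_le (show 0 ≤ 2 * (51 * z) by positivity)
  change _ ≤ 2 * (51 * z) * F.E τ at h3
  have h4 : |(1/2) * exp (-2*τ) * (F.P τ * W)| ≤ z ^ 4 := by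
    rw [h.exp_neg_two_eq, abs_mul, abs_mul (F.P τ),
      abs_of_pos (show 0 < 1 / 2 * z ^ 4 by positivity)]
    have e := mul_le_mul h.abs_P_le hW (abs_nonneg _) (by norm_num)
    have e2 : 10405 * (30000 * z) ≤ 2 := by linarith [h.z_small]
    have := mul_le_mul_of_nonneg_left (e.trans e2) (show 0 ≤ 1 / 2 * z ^ 4 by positivity)
    linarith
  have h2' := abs_le.1 h2
  have h3'' := abs_le.1 (h3.trans h3')
  have h4' := abs_le.1 h4
  have hz4 : 0 < z ^ 4 := by positivity
  rw [abs_le]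
  constructor <;> nlinarith

lemma abs_energy_sub_le : |exp τ * (F.Pi τ * F.E τ) - F.almostConserved τ| ≤ 10 ^ 6 * z := by
  have hz := h.z_pos
  have e : exp τ * (F.Pi τ * F.E τ) - F.almostConserved τ
      = exp τ * (F.Pi τ * (-F.corr τ)) := by rw [almostConserved]; ring
  rw [e]
  refine (h.abs_exp_mul_Pi_mul_le (K := 6504) ?_).trans (by linarith)
  rw [abs_neg]; exact h.abs_corr_le

lemma abs_H_sub_le : |exp τ * F.H τ - F.almostConserved τ| ≤ 10 ^ 6 * z := by
  have hz := h.z_pos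
  have e : F.Λ τ = F.corr τ
      + (1/2) * exp (-2*τ) * (F.P τ * (F.S τ / F.Pi τ - circleMean (F.V τ))) := by
    have : ∫ θ in (0:ℝ)..1, F.Vτ τ θ * (F.V τ θ - circleMean (F.V τ) - 1) * exp (F.ρ τ θ)
        = F.R τ - F.P τ * (circleMean (F.V τ) + 1) := by
      rw [R, P, ← intervalIntegral.integral_mul_const,
        ← integral_unit_sub (by fun_prop) (by fun_prop)]
      refine intervalIntegral.integral_congr fun θ _ => ?_
      ring
    rw [Λ, this, corr]; ring
  have e2 : exp τ * F.H τ - F.almostConserved τ = exp τ * (F.Pi τ *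
      ((1/2) * exp (-2*τ) * (F.P τ * (F.S τ / F.Pi τ - circleMean (F.V τ))))) := by
    rw [H, e, almostConserved]; ring
  rw [e2]
  refine (h.abs_exp_mul_Pi_mul_le (K := 1) ?_).trans (by linarith)
  rw [h.exp_neg_two_eq, abs_mul, abs_mul (F.P τ), abs_of_pos (show 0 < 1 / 2 * z ^ 4 by positivity),
    abs_sub_comm]
  have e := mul_le_mul h.abs_P_le h.abs_circleMean_sub_le (abs_nonneg _) (by norm_num)
  have e2 : 10405 * (51 * z) ≤ 2 := by linarith [h.z_small]
  have := mul_le_mul_of_nonneg_left (e.trans e2) (show 0 ≤ 1 / 2 * z ^ 4 by positivity)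
  linarith

end Controlled

end T2Flow

lemma le_of_hasDerivAt_nonpos {f : ℝ → ℝ} {s t : ℝ} (hst : s ≤ t)
    (h : ∀ x ∈ Set.Icc s t, ∃ D, HasDerivAt f D x ∧ D ≤ 0) : f t ≤ f s := by
  refine antitoneOn_of_deriv_nonpos (convex_Icc s t) (fun x hx => ?_) (fun x hx => ?_)
    (fun x hx => ?_) (Set.left_mem_Icc.2 hst) (Set.right_mem_Icc.2 hst) hst
  · obtain ⟨D, hD, -⟩ := h x hx
    exact hD.continuousAt.continuousWithinAt
  · obtain ⟨D, hD, -⟩ := h x (interior_subset hx)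
    exact hD.differentiableAt.differentiableWithinAt
  · obtain ⟨D, hD, h0⟩ := h x (interior_subset hx)
    rwa [hD.deriv]

/-- The continuity method: a continuous function that starts negative and cannot vanish
before being shown to be negative stays negative. -/
lemma neg_of_bootstrap {f : ℝ → ℝ} (hf : Continuous f) {s : ℝ} (hs : f s < 0)
    (h : ∀ T, s ≤ T → (∀ t ∈ Set.Icc s T, f t ≤ 0) → f T < 0) : ∀ t, s ≤ t → f t < 0 := by
  intro t hst
  by_contra! ht
  have hc : IsCompact (Set.Icc s t ∩ f ⁻¹' Set.Ici 0) :=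
    isCompact_Icc.inter_right (isClosed_Ici.preimage hf)
  obtain ⟨T, ⟨hT, hfT⟩, hmin⟩ := hc.exists_isLeast ⟨t, ⟨hst, le_rfl⟩, ht⟩
  have hfT' : (0:ℝ) ≤ f T := hfT
  refine absurd (h T hT.1 fun x hx => ?_) (not_lt.2 hfT')
  by_contra! hx0
  obtain ⟨y, hy, hy0⟩ := intermediate_value_Icc hx.1 hf.continuousOn ⟨hs.le, hx0.le⟩
  have h1 : T ≤ y := hmin ⟨⟨hy.1, hy.2.trans (hx.2.trans hT.2)⟩, hy0.ge⟩
  have h2 : y = x := le_antisymm hy.2 (hx.2.trans h1)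
  rw [h2] at hy0
  exact hx0.ne' hy0

/-- The Lyapunov function of the linear system `α' = -α/2 + β`, `β' = -5α/2`. -/
def lyapunov (a b : ℝ) : ℝ := (5/2) * a ^ 2 - (1/2) * (a * b) + b ^ 2

lemma le_lyapunov (a b : ℝ) : 2 * a ^ 2 + (3/4) * b ^ 2 ≤ lyapunov a b := by
  unfold lyapunov; nlinarith [sq_nonneg (a - b / 2), sq_nonneg (a + b), sq_nonneg a, sq_nonneg b]

lemma abs_le_of_lyapunov_le {a b σ : ℝ} (hσ : 0 ≤ σ) (h : lyapunov a b ≤ σ ^ 2) :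
    |a| ≤ σ ∧ |b| ≤ 2 * σ := by
  have := le_lyapunov a b
  constructor
  · exact abs_le_of_sq_le_sq (by nlinarith [sq_nonneg a, sq_nonneg b]) hσ
  · exact abs_le_of_sq_le_sq (by nlinarith [sq_nonneg a, sq_nonneg b]) (by positivity)

lemma lyapunov_le {α β : ℝ → ℝ} {s t η : ℝ} (hst : s ≤ t)
    (h : ∀ x ∈ Set.Icc s t, ∃ g, HasDerivAt α (-α x / 2 + β x) x ∧
      HasDerivAt β (-(5/2) * α x + g) x ∧ (2 * β x - α x / 2) * g ≤ η / 2)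
    (h0 : lyapunov (α s) (β s) ≤ η) : lyapunov (α t) (β t) ≤ η := by
  have key := le_of_hasDerivAt_nonpos
    (f := fun x => exp (x / 2) * (lyapunov (α x) (β x) - η)) hst fun x hx => ?_
  · have h1 : exp (s / 2) * (lyapunov (α s) (β s) - η) ≤ 0 :=
      mul_nonpos_of_nonneg_of_nonpos (exp_pos _).le (by linarith)
    have h2 := nonpos_of_mul_nonpos_right (key.trans h1) (exp_pos _)
    linarith
  obtain ⟨g, ha, hb, hg⟩ := h x hx
  have e1 : HasDerivAt (fun y : ℝ => exp (y / 2)) (exp (x / 2) * (1 / 2)) x :=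
    ((hasDerivAt_id' x).div_const 2).exp
  have e2 := (((((ha.fun_pow 2).const_mul (5/2)).fun_sub ((ha.fun_mul hb).const_mul (1/2))).fun_add
    (hb.fun_pow 2)).sub_const η)
  refine ⟨_, e1.fun_mul e2, ?_⟩
  have e3 : exp (x / 2) * ((2 * β x - α x / 2) * g - η / 2) ≤ 0 :=
    mul_nonpos_of_nonneg_of_nonpos (exp_pos _).le (by linarith)
  refine le_of_eq_of_le ?_ e3
  simp only [lyapunov]
  push_cast
  ring

/-- The quadratic part of the `β`-equation. -/
lemma abs_nonlinearity_le {a b σ : ℝ} (hσ : σ ≤ 1 / 1000) (ha : |a| ≤ σ) (hb : |b| ≤ 2 * σ) :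
    |-(5/2) * (1 + b) + 10 * (1 + b) / (2 + a) ^ 2 + (5/2) * a| ≤ 20 * σ ^ 2 := by
  have h0 : 0 ≤ σ := (abs_nonneg _).trans ha
  have ha' := abs_le.1 ha
  have hb' := abs_le.1 hb
  have hpos : 0 < 2 + a := by linarith
  have e : -(5/2) * (1 + b) + 10 * (1 + b) / (2 + a) ^ 2 + (5/2) * a
      = (5/2) * (a * (a * (3 - b + a) - 4 * b)) / (2 + a) ^ 2 := by
    field_simp; ring
  have h1 : |a * (3 - b + a) - 4 * b| ≤ 12 * σ := by
    have e1 : |a * (3 - b + a)| ≤ σ * 4 := by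
      rw [abs_mul]
      exact mul_le_mul ha (abs_le.2 ⟨by linarith, by linarith⟩) (abs_nonneg _) h0
    have e1' := abs_le.1 e1
    rw [abs_le]; constructor <;> linarith
  have h2 : |a * (a * (3 - b + a) - 4 * b)| ≤ 12 * σ ^ 2 := by
    rw [abs_mul]
    refine (mul_le_mul ha h1 (abs_nonneg _) h0).trans_eq ?_
    ring
  rw [e, abs_div, abs_of_pos (show 0 < (2 + a) ^ 2 by positivity), div_le_iff₀ (by positivity),
    abs_mul, abs_of_pos (show (0:ℝ) < 5/2 by norm_num)]
  have h3 : 3 ≤ (2 + a) ^ 2 := by nlinarith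
  nlinarith [sq_nonneg σ]

/-- The full error term in the `β`-equation. -/
lemma abs_error_le {a b σ r e δ : ℝ} (hσ : σ ≤ 1 / 1000) (ha : |a| ≤ σ) (hb : |b| ≤ 2 * σ)
    (hr : |r| ≤ δ) (he : |e| ≤ δ) :
    |-(5/2) * (1 + b) + 10 * (1 + b) * (1 + r) / (2 + a) ^ 2 + e + (5/2) * a|
      ≤ 20 * σ ^ 2 + 5 * δ := by
  have ha' := abs_le.1 ha
  have hb' := abs_le.1 hb
  have h1 := abs_le.1 (abs_nonlinearity_le hσ ha hb)
  have hpos : 0 < 2 + a := by linarith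
  have h3 : 3 ≤ (2 + a) ^ 2 := by nlinarith
  have h4 : |10 * (1 + b) / (2 + a) ^ 2 * r| ≤ 4 * δ := by
    rw [abs_mul]
    refine mul_le_mul ?_ hr (abs_nonneg _) (by norm_num)
    rw [abs_of_nonneg (div_nonneg (by linarith) (by positivity)), div_le_iff₀ (by positivity)]
    linarith
  have h4' := abs_le.1 h4
  have he' := abs_le.1 he
  have e : -(5/2) * (1 + b) + 10 * (1 + b) * (1 + r) / (2 + a) ^ 2 + e + (5/2) * a
      = (-(5/2) * (1 + b) + 10 * (1 + b) / (2 + a) ^ 2 + (5/2) * a)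
        + 10 * (1 + b) / (2 + a) ^ 2 * r + e := by
    field_simp; ring
  rw [e, abs_le]
  constructor <;> linarith

/-- Comparison of the normalizations by `κ` and by a nearby constant. -/
lemma abs_normalized_sub_le {κ K k a x : ℝ} (hκ : 1 / 2 ≤ κ) (hκ4 : κ ≤ 4) (hK : 1 / 4 ≤ K)
    (hk : 0 < k) (hk2 : 10 * k ^ 2 = κ) (ha : 0 ≤ a) (ha2 : a ≤ 2) :
    |k * (a + x) / √K - a / √10| ≤ 2 * |x| + 8 * |K - κ| := by
  have hsK : 1 / 2 ≤ √K := by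
    rw [show (1:ℝ) / 2 = √(1 / 4) by rw [show (1:ℝ)/4 = (1/2)^2 by norm_num, sqrt_sq (by norm_num)]]
    exact sqrt_le_sqrt hK
  have hsκ : 1 / 2 ≤ √κ := by
    rw [show (1:ℝ) / 2 = √(1 / 4) by rw [show (1:ℝ)/4 = (1/2)^2 by norm_num, sqrt_sq (by norm_num)]]
    exact sqrt_le_sqrt (by linarith)
  have hk1 : k ≤ 1 := by nlinarith
  have h10 : √κ = √10 * k := by
    rw [← hk2, sqrt_mul (by norm_num), sqrt_sq hk.le]
  have hs10 : 0 < √(10:ℝ) := by positivity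
  have hdiff : |√κ - √K| ≤ |K - κ| := by
    have e : (√κ - √K) * (√κ + √K) = κ - K := by
      have e1 := sq_sqrt (show 0 ≤ κ by linarith)
      have e2 := sq_sqrt (show 0 ≤ K by linarith)
      nlinarith
    rw [abs_sub_comm K, ← e, abs_mul]
    refine le_mul_of_one_le_right (abs_nonneg _) ?_
    rw [abs_of_pos (by linarith)]; linarith
  have hsKpos : 0 < √K := by linarith
  have e : k * (a + x) / √K - a / √10 = k / √K * x + a * k / (√κ * √K) * (√κ - √K) := by
    have hsκpos : 0 < √κ := by linarith
    have : a / √10 = a * k / √κ := by rw [h10]; field_simp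
    rw [this]
    field_simp
    ring
  have h1 : |k / √K * x| ≤ 2 * |x| := by
    rw [abs_mul]
    refine mul_le_mul_of_nonneg_right ?_ (abs_nonneg _)
    rw [abs_of_pos (by positivity), div_le_iff₀ hsKpos]; linarith
  have h2 : |a * k / (√κ * √K) * (√κ - √K)| ≤ 8 * |K - κ| := by
    rw [abs_mul]
    refine mul_le_mul ?_ hdiff (abs_nonneg _) (by norm_num)
    have : 1 / 4 ≤ √κ * √K := by nlinarith
    rw [abs_of_nonneg (by positivity), div_le_iff₀ (by linarith)]
    nlinarith
  rw [e]
  exact (abs_add_le _ _).trans (add_le_add h1 h2)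

lemma hasDerivAt_exp_neg_half (τ : ℝ) :
    HasDerivAt (fun s : ℝ => exp (-(s / 2))) (-(exp (-(τ / 2)) / 2)) τ :=
  (((hasDerivAt_id' τ).div_const 2).fun_neg.exp).congr_deriv (by ring)

lemma exp_neg_half_sq_mul (τ : ℝ) : exp (-(τ / 2)) ^ 2 * exp τ = 1 := by
  rw [sq, ← exp_add, ← exp_add, ← exp_zero]; ring_nf

namespace T2Flow

/-- The volume normalized by its expected growth. -/
def normVol (F : T2Flow) (τ : ℝ) : ℝ := F.Pi τ * exp (-(τ / 2))
/-- The twist potential normalized by its expected growth. -/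
def normTwist (F : T2Flow) (τ : ℝ) : ℝ := F.Y τ * exp (-(τ / 2)) ^ 5
/-- The volume times energy normalized by its expected decay. -/
def normEnergy (F : T2Flow) (τ : ℝ) : ℝ := exp τ * (F.Pi τ * F.E τ)

variable {F : T2Flow} {τ : ℝ}

lemma IsEinsteinFlow.hasDerivAt_normVol (hF : F.IsEinsteinFlow) :
    HasDerivAt F.normVol (-F.normVol τ / 2 + F.normTwist τ) τ := by
  refine ((hF.hasDerivAt_Pi τ).fun_mul (hasDerivAt_exp_neg_half τ)).congr_deriv ?_
  have hm : ∫ θ in (0:ℝ)..1, exp (F.l τ θ) * exp (F.ρ τ θ) = F.lapse τ * F.Pi τ :=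
    (div_mul_cancel₀ _ (F.Pi_pos τ).ne').symm
  have hz := exp_neg_half_sq_mul τ
  rw [hm, normVol, normTwist, ← F.lapse_eq, exp_two_mul']
  linear_combination (-F.lapse τ * F.Pi τ * exp (-(τ / 2))
    * (exp (-(τ / 2)) ^ 2 * exp τ + 1)) * hz

lemma IsEinsteinFlow.hasDerivAt_normTwist (hF : F.IsEinsteinFlow) :
    HasDerivAt F.normTwist (-(5/2) * F.normTwist τ
      + F.normTwist τ * F.normEnergy τ / F.normVol τ ^ 2
      - (exp (-(τ / 2)) ^ 3)⁻¹
        * (F.lapse τ * F.E τ - ∫ θ in (0:ℝ)..1, exp (F.l τ θ) * F.eDens τ θ)) τ := by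
  refine ((hF.hasDerivAt_Y τ).fun_mul ((hasDerivAt_exp_neg_half τ).fun_pow 5)).congr_deriv ?_
  have hp := (F.Pi_pos τ).ne'
  have hz0 : exp (-(τ / 2)) ≠ 0 := (exp_pos _).ne'
  have he : exp τ = (exp (-(τ / 2)) ^ 2)⁻¹ := eq_inv_of_mul_eq_one_right (exp_neg_half_sq_mul τ)
  rw [normVol, normTwist, normEnergy, ← F.lapse_eq, show 4*τ = 2*(2*τ) by ring, exp_two_mul',
    exp_two_mul' τ, he]
  generalize exp (-(τ / 2)) = z at *
  push_cast
  field_simp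
  ring

lemma Controlled.exists_hasDerivAt_normTwist (h : F.Controlled τ (exp (-(τ / 2)))) :
    ∃ e, HasDerivAt F.normTwist (-(5/2) * F.normTwist τ
      + F.normTwist τ * F.normEnergy τ / F.normVol τ ^ 2 + e) τ
      ∧ |e| ≤ 10200 * exp (-(τ / 2)) := by
  refine ⟨_, (h.flow.hasDerivAt_normTwist).congr_deriv (sub_eq_add_neg _ _), ?_⟩
  have hz := h.z_pos
  rw [abs_neg, abs_mul, abs_of_pos (by positivity)]
  refine (mul_le_mul_of_nonneg_left h.abs_lapse_mul_E_sub_le (by positivity)).trans_eq ?_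
  field_simp

/-- The hypotheses at the initial time, with `κ = e^s H(s) = 10 k²`. -/
structure BootstrapData (F : T2Flow) (s κ k σ : ℝ) : Prop where
  flow : F.IsEinsteinFlow
  B_zero : ∀ τ, F.B τ = 0
  abs_A : |F.A s| ≤ 1
  σ_pos : 0 < σ
  σ_small : σ ≤ 1 / 10 ^ 12
  κ_eq : κ = exp s * F.H s
  half_le : 1 / 2 ≤ κ
  le_four : κ ≤ 4
  k_pos : 0 < k
  k_sq : 10 * k ^ 2 = κ
  exp_le : exp (-(s / 2)) ≤ 3 / 2 * σ ^ 2

/-- The normalized deviation of the volume. -/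
def devVol (F : T2Flow) (k τ : ℝ) : ℝ := F.normVol τ / k - 2
/-- The normalized deviation of the twist potential. -/
def devTwist (F : T2Flow) (k τ : ℝ) : ℝ := F.normTwist τ / k - 1

/-- The bootstrap assumption at a single time. -/
def Bootstrap (F : T2Flow) (k σ τ : ℝ) : Prop :=
  lyapunov (F.devVol k τ) (F.devTwist k τ) ≤ σ ^ 2 ∧ F.normEnergy τ ≤ 20

namespace BootstrapData

variable {s κ k σ : ℝ} (h : F.BootstrapData s κ k σ)
include h

lemma normVol_eq (τ : ℝ) : F.normVol τ = k * (2 + F.devVol k τ) := by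
  have := h.k_pos.ne'
  rw [devVol]; field_simp; ring

lemma normTwist_eq (τ : ℝ) : F.normTwist τ = k * (1 + F.devTwist k τ) := by
  have := h.k_pos.ne'
  rw [devTwist]; field_simp; ring

lemma k_ge : 11 / 50 ≤ k := by nlinarith [h.k_sq, h.half_le, h.k_pos]

lemma k_le : k ≤ 16 / 25 := by nlinarith [h.k_sq, h.le_four, h.k_pos]

lemma controlled (hsτ : s ≤ τ) (hb : F.Bootstrap k σ τ) : F.Controlled τ (exp (-(τ / 2))) := by
  obtain ⟨ha, hb'⟩ := abs_le_of_lyapunov_le h.σ_pos.le hb.1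
  have ha := abs_le.1 ha
  have hb' := abs_le.1 hb'
  have hσ := h.σ_small
  have hσ0 := h.σ_pos
  have hk1 := h.k_ge
  have hk2 := h.k_le
  have hu := h.normVol_eq τ
  have hw := h.normTwist_eq τ
  have hu1 : 2 / 5 ≤ F.normVol τ := by rw [hu]; nlinarith
  have hz : 0 < exp (-(τ / 2)) := exp_pos _
  refine ⟨h.flow, hz, exp_neg_half_sq_mul τ, ?_, hu1, ?_, ?_, ?_, ?_, h.B_zero τ⟩
  · have : exp (-(τ / 2)) ≤ exp (-(s / 2)) := exp_le_exp.2 (by linarith)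
    nlinarith [h.exp_le]
  · change F.normVol τ ≤ _
    rw [hu]; nlinarith
  · have he : exp τ = (exp (-(τ / 2)) ^ 2)⁻¹ := eq_inv_of_mul_eq_one_right (exp_neg_half_sq_mul τ)
    have hX := hb.2
    rw [normVol] at hu1
    rw [normEnergy, he, ← div_eq_inv_mul, div_le_iff₀ (by positivity)] at hX
    generalize exp (-(τ / 2)) = z at *
    have e1 : (2 / 5) * F.E τ ≤ (F.Pi τ * z) * F.E τ :=
      mul_le_mul_of_nonneg_right hu1 (F.E_nonneg τ)
    have e2 := mul_le_mul_of_nonneg_right hX hz.le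
    nlinarith
  · change F.normTwist τ ≤ _
    rw [hw]; nlinarith
  · rw [h.flow.A_eq τ s]; exact h.abs_A

lemma abs_almostConserved_sub_le {t : ℝ} (hst : s ≤ t)
    (hb : ∀ x ∈ Set.Icc s t, F.Bootstrap k σ x) :
    |F.almostConserved t - F.almostConserved s| ≤ 2 * 10 ^ 6 * exp (-(s / 2)) := by
  have hz : 0 < exp (-(t / 2)) := exp_pos _
  have h1 := le_of_hasDerivAt_nonpos
    (f := fun x => F.almostConserved x + 2 * 10 ^ 6 * exp (-(x / 2))) hst fun x hx => by
      obtain ⟨D, hD, hD'⟩ := (h.controlled hx.1 (hb x hx)).exists_hasDerivAt_almostConserved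
      refine ⟨_, hD.fun_add ((hasDerivAt_exp_neg_half x).const_mul (2 * 10 ^ 6)), ?_⟩
      linarith [(abs_le.1 hD').2]
  have h2 := le_of_hasDerivAt_nonpos
    (f := fun x => 2 * 10 ^ 6 * exp (-(x / 2)) - F.almostConserved x) hst fun x hx => by
      obtain ⟨D, hD, hD'⟩ := (h.controlled hx.1 (hb x hx)).exists_hasDerivAt_almostConserved
      refine ⟨_, ((hasDerivAt_exp_neg_half x).const_mul (2 * 10 ^ 6)).fun_sub hD, ?_⟩
      linarith [(abs_le.1 hD').1]
  rw [abs_le]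
  constructor <;> linarith

lemma abs_energy_sub_le {t : ℝ} (hst : s ≤ t) (hb : ∀ x ∈ Set.Icc s t, F.Bootstrap k σ x) :
    |exp t * F.H t - κ| ≤ 10 ^ 7 * σ ^ 2 ∧ |F.normEnergy t - κ| ≤ 10 ^ 7 * σ ^ 2 := by
  have hct := h.controlled hst (hb t ⟨hst, le_rfl⟩)
  have hcs := h.controlled le_rfl (hb s ⟨le_rfl, hst⟩)
  have hz : exp (-(t / 2)) ≤ exp (-(s / 2)) := exp_le_exp.2 (by linarith)
  have h1 := abs_le.1 (h.abs_almostConserved_sub_le hst hb)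
  have h2 := abs_le.1 hct.abs_H_sub_le
  have h3 := abs_le.1 hcs.abs_H_sub_le
  have h4 := abs_le.1 hct.abs_energy_sub_le
  have h5 := h.exp_le
  rw [← h.κ_eq] at h3
  rw [normEnergy, abs_le, abs_le]
  refine ⟨⟨?_, ?_⟩, ⟨?_, ?_⟩⟩ <;> linarith

lemma hasDerivAt_devVol (τ : ℝ) :
    HasDerivAt (F.devVol k) (-F.devVol k τ / 2 + F.devTwist k τ) τ := by
  refine ((h.flow.hasDerivAt_normVol.div_const k).sub_const 2).congr_deriv ?_
  rw [devVol, devTwist]; ring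

lemma exists_hasDerivAt_devTwist {t : ℝ} (hst : s ≤ t)
    (hb : ∀ x ∈ Set.Icc s t, F.Bootstrap k σ x) :
    ∃ g, HasDerivAt (F.devTwist k) (-(5/2) * F.devVol k t + g) t ∧ |g| ≤ 11 * 10 ^ 7 * σ ^ 2 := by
  have hbt := hb t ⟨hst, le_rfl⟩
  obtain ⟨e, he, hle⟩ := (h.controlled hst hbt).exists_hasDerivAt_normTwist
  have hX := (h.abs_energy_sub_le hst hb).2
  obtain ⟨ha, hb'⟩ := abs_le_of_lyapunov_le h.σ_pos.le hbt.1
  have hz : exp (-(t / 2)) ≤ exp (-(s / 2)) := exp_le_exp.2 (by linarith)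
  have hk := h.k_pos
  have hk1 := h.k_ge
  have hκ : 0 < κ := by linarith [h.half_le]
  have hr : |F.normEnergy t / κ - 1| ≤ 2 * 10 ^ 7 * σ ^ 2 := by
    rw [show F.normEnergy t / κ - 1 = (F.normEnergy t - κ) / κ by field_simp, abs_div,
      abs_of_pos hκ, div_le_iff₀ hκ]
    nlinarith [h.half_le, sq_nonneg σ]
  have hek : |e / k| ≤ 2 * 10 ^ 7 * σ ^ 2 := by
    rw [abs_div, abs_of_pos hk, div_le_iff₀ hk]
    nlinarith [h.exp_le, sq_nonneg σ]
  have herr := abs_error_le (by linarith [h.σ_small]) ha hb' hr hek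
  refine ⟨_, ((he.div_const k).sub_const 1).congr_deriv ?_, herr.trans (by
    nlinarith [sq_nonneg σ])⟩
  have h2a : 2 + F.devVol k t ≠ 0 := by
    have := (abs_le.1 ha).1
    have := h.σ_small
    linarith
  rw [h.normVol_eq, h.normTwist_eq, ← h.k_sq]
  field_simp
  ring

/-- Improvement of the bootstrap assumption. -/
lemma lyapunov_improve {t : ℝ} (hst : s ≤ t) (hb : ∀ x ∈ Set.Icc s t, F.Bootstrap k σ x)
    (h0 : lyapunov (F.devVol k s) (F.devTwist k s) ≤ 10 ^ 9 * σ ^ 3) :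
    lyapunov (F.devVol k t) (F.devTwist k t) ≤ 10 ^ 9 * σ ^ 3 := by
  refine lyapunov_le hst (fun x hx => ?_) h0
  obtain ⟨g, hg, hle⟩ := h.exists_hasDerivAt_devTwist hx.1
    fun y hy => hb y ⟨hy.1, hy.2.trans hx.2⟩
  refine ⟨g, h.hasDerivAt_devVol x, hg, ?_⟩
  obtain ⟨ha, hb'⟩ := abs_le_of_lyapunov_le h.σ_pos.le (hb x hx).1
  have ha := abs_le.1 ha
  have hb' := abs_le.1 hb'
  have h1 : |2 * F.devTwist k x - F.devVol k x / 2| ≤ 9 / 2 * σ := by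
    rw [abs_le]; constructor <;> linarith
  have h2 := mul_le_mul h1 hle (abs_nonneg _) (by linarith [h.σ_pos])
  rw [← abs_mul] at h2
  have h3 : 0 < σ ^ 3 := pow_pos h.σ_pos 3
  linarith [(abs_le.1 h2).2]

omit h in
lemma lyapunov_lt (hσ : σ ≤ 1 / 10 ^ 12) {N : ℝ} (hN : N ≤ 10 ^ 9 * σ ^ 3) :
    N ≤ (σ / 10) ^ 2 := by
  have : σ ^ 3 ≤ 1 / 10 ^ 12 * σ ^ 2 := by
    rw [pow_succ' σ 2]; exact mul_le_mul_of_nonneg_right hσ (sq_nonneg σ)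
  nlinarith [sq_nonneg σ]

lemma bootstrap (h0 : lyapunov (F.devVol k s) (F.devTwist k s) ≤ 10 ^ 9 * σ ^ 3)
    (hX : F.normEnergy s < 20) : ∀ t, s ≤ t → F.Bootstrap k σ t := by
  have hσ := h.σ_pos
  have hlt : (σ / 10) ^ 2 < σ ^ 2 := by nlinarith [pow_pos hσ 2]
  have hvol : Continuous F.normVol :=
    continuous_iff_continuousAt.2 fun x => (h.flow.hasDerivAt_normVol (τ := x)).continuousAt
  have htw : Continuous F.normTwist :=
    continuous_iff_continuousAt.2 fun x => (h.flow.hasDerivAt_normTwist (τ := x)).continuousAt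
  have hen : Continuous F.normEnergy :=
    continuous_iff_continuousAt.2 fun x => ((hasDerivAt_exp x).fun_mul
      ((h.flow.hasDerivAt_Pi x).fun_mul (h.flow.hasDerivAt_E x))).continuousAt
  have hcont : Continuous fun t =>
      max (lyapunov (F.devVol k t) (F.devTwist k t) - σ ^ 2) (F.normEnergy t - 20) := by
    unfold lyapunov devVol devTwist
    fun_prop
  have key := neg_of_bootstrap hcont (s := s) ?_ ?_
  · intro t ht
    have := max_lt_iff.1 (key t ht)
    exact ⟨by linarith [this.1], by linarith [this.2]⟩
  · exact max_lt (by linarith [lyapunov_lt h.σ_small h0]) (by linarith)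
  · intro T hT hle
    have hb : ∀ x ∈ Set.Icc s T, F.Bootstrap k σ x := fun x hx => by
      have := max_le_iff.1 (hle x hx)
      exact ⟨by linarith [this.1], by linarith [this.2]⟩
    refine max_lt (by linarith [lyapunov_lt h.σ_small (h.lyapunov_improve hT hb h0)]) ?_
    have := (abs_le.1 (h.abs_energy_sub_le hT hb).2).2
    nlinarith [h.le_four, h.σ_small]

end BootstrapData

end T2Flow

namespace T2Flow

variable {F : T2Flow} {τ : ℝ}

lemma exp_mul_sqrt_H : exp τ * √(F.H τ) * exp (-(τ / 2)) = √(exp τ * F.H τ) := by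
  rw [sqrt_mul (exp_pos τ).le, ← exp_half, mul_right_comm, ← exp_add]
  ring_nf

lemma c_eq : F.c τ = F.normVol τ / √(exp τ * F.H τ) - 2 / √10 := by
  rw [c, normVol, ← exp_mul_sqrt_H, mul_div_mul_right _ _ (exp_pos _).ne']

lemma d_eq : F.d τ = F.normTwist τ / √(exp τ * F.H τ) - 1 / √10 := by
  have e : exp (3*τ) * √(F.H τ) * exp (-(τ / 2)) ^ 5 = √(exp τ * F.H τ) := by
    rw [← exp_mul_sqrt_H, mul_right_comm, mul_right_comm (exp τ), ← exp_nat_mul, ← exp_add,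
      ← exp_add]
    congr 2
    push_cast
    ring
  rw [d, normTwist, ← e, mul_div_mul_right _ _ (pow_pos (exp_pos _) 5).ne']

lemma energy_div_H : F.Pi τ * F.E τ / F.H τ = F.normEnergy τ / (exp τ * F.H τ) := by
  rw [normEnergy, mul_div_mul_left _ _ (exp_pos τ).ne']

namespace BootstrapData

variable {s κ k σ : ℝ} (h : F.BootstrapData s κ k σ)
include h

lemma sqrt_κ : √κ = √10 * k := by
  rw [← h.k_sq, sqrt_mul (by norm_num), sqrt_sq h.k_pos.le]

lemma initial (hc : |F.c s| < σ ^ 4) (hd : |F.d s| < σ ^ 4)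
    (hE : |F.Pi s * F.E s / F.H s - 1| < 1) :
    lyapunov (F.devVol k s) (F.devTwist k s) ≤ 10 ^ 9 * σ ^ 3 ∧ F.normEnergy s < 20 := by
  have hk := h.k_pos
  have h10 : 0 < √(10:ℝ) := by positivity
  have h10' : √(10:ℝ) ≤ 4 := by
    rw [show (4:ℝ) = √(4 ^ 2) by rw [sqrt_sq (by norm_num)]]
    exact sqrt_le_sqrt (by norm_num)
  have ha : F.devVol k s = √10 * F.c s := by
    rw [c_eq, ← h.κ_eq, h.sqrt_κ, devVol]; field_simp
  have hb : F.devTwist k s = √10 * F.d s := by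
    rw [d_eq, ← h.κ_eq, h.sqrt_κ, devTwist]; field_simp
  have ha' : |F.devVol k s| ≤ 4 * σ ^ 4 := by
    rw [ha, abs_mul, abs_of_pos h10]
    exact mul_le_mul h10' hc.le (abs_nonneg _) (by norm_num)
  have hb' : |F.devTwist k s| ≤ 4 * σ ^ 4 := by
    rw [hb, abs_mul, abs_of_pos h10]
    exact mul_le_mul h10' hd.le (abs_nonneg _) (by norm_num)
  constructor
  · have e1 := sq_le_sq' (abs_le.1 ha').1 (abs_le.1 ha').2
    have e2 := sq_le_sq' (abs_le.1 hb').1 (abs_le.1 hb').2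
    have e3 : lyapunov (F.devVol k s) (F.devTwist k s) ≤ 5 * (4 * σ ^ 4) ^ 2 := by
      unfold lyapunov
      nlinarith [sq_nonneg (F.devVol k s + F.devTwist k s)]
    have e4 : σ ^ 5 ≤ 1 := pow_le_one₀ h.σ_pos.le (by linarith [h.σ_small])
    have e5 := mul_le_mul_of_nonneg_left e4 (pow_pos h.σ_pos 3).le
    have e6 : σ ^ 3 * σ ^ 5 = (σ ^ 4) ^ 2 := by ring
    nlinarith [pow_pos h.σ_pos 3]
  · have hκ : 0 < κ := by linarith [h.half_le]
    rw [energy_div_H, ← h.κ_eq] at hE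
    have : F.normEnergy s / κ < 2 := by linarith [(abs_lt.1 hE).2]
    rw [div_lt_iff₀ hκ] at this
    linarith [h.le_four]

lemma conclusion (h0 : lyapunov (F.devVol k s) (F.devTwist k s) ≤ 10 ^ 9 * σ ^ 3)
    (hX : F.normEnergy s < 20) (hτ : s ≤ τ) :
    |F.c τ| < σ ∧ |F.d τ| < σ ∧ |F.Pi τ * F.E τ / F.H τ - 1| < 3 ∧
      (1/2) * (κ - 1 * σ ^ 2) < exp τ * F.H τ ∧ exp τ * F.H τ < 2 * (κ + 1 * σ ^ 2) := by
  have hb := h.bootstrap h0 hX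
  have hb' : ∀ x ∈ Set.Icc s τ, F.Bootstrap k σ x := fun x hx => hb x hx.1
  obtain ⟨hH, hE⟩ := h.abs_energy_sub_le hτ hb'
  have hσ := h.σ_pos
  have hσs := h.σ_small
  have hsq : 10 ^ 7 * σ ^ 2 ≤ 1 / 10 ^ 5 * σ := by nlinarith
  obtain ⟨ha, hb⟩ := abs_le_of_lyapunov_le (by positivity)
    (lyapunov_lt h.σ_small (h.lyapunov_improve hτ hb' h0))
  have hH' := abs_le.1 hH
  have hE' := abs_le.1 hE
  have hκ := h.half_le
  have hK : 1 / 4 ≤ exp τ * F.H τ := by linarith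
  refine ⟨?_, ?_, ?_, ?_, ?_⟩
  · rw [c_eq, h.normVol_eq]
    have := abs_normalized_sub_le (x := F.devVol k τ) hκ h.le_four hK h.k_pos h.k_sq
      zero_le_two le_rfl
    linarith
  · rw [d_eq, h.normTwist_eq]
    have := abs_normalized_sub_le (x := F.devTwist k τ) hκ h.le_four hK h.k_pos h.k_sq
      zero_le_one one_le_two
    linarith
  · have hKpos : 0 < exp τ * F.H τ := by linarith
    rw [energy_div_H, div_sub_one hKpos.ne', abs_div, abs_of_pos hKpos, div_lt_iff₀ hKpos, abs_lt]
    constructor <;> linarith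
  · nlinarith
  · nlinarith

end BootstrapData

end T2Flow

/-- The bootstrap lemma: there are `ε₀, C₁ > 0` and `M > 1` such that any `B₀`
T²-symmetric Einstein flow satisfying the smallness conditions at a time `s₀ > 0`
(for `0 < ε ≤ ε₀`) satisfies the weaker estimates for all `τ ≥ s₀`. -/
theorem bootstrap_lemma :
    ∃ ε₀ C₁ M : ℝ, 0 < ε₀ ∧ 0 < C₁ ∧ 1 < M ∧
      ∀ ε : ℝ, 0 < ε → ε ≤ ε₀ →
      ∀ (F : T2Flow), F.IsEinsteinFlow → (∀ τ : ℝ, F.B τ = 0) →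
      ∀ s₀ : ℝ, 0 < s₀ →
        |F.A s₀| < 1 →
        0 < (⨅ θ : ℝ, F.ρ s₀ θ) →
        |F.c s₀| < ε →
        |F.d s₀| < ε →
        |F.Pi s₀ * F.E s₀ / F.H s₀ - 1| < 1 →
        (1/2) * ε⁻¹ < Real.exp s₀ →
        Real.exp s₀ < 2 * ε⁻¹ →
        Real.exp s₀ * F.H s₀ + C₁ * Real.sqrt ε < M * ε * Real.exp s₀ →
        0 < 1 / M →
        1 / M < Real.exp s₀ * F.H s₀ - C₁ * Real.sqrt ε →
        ∀ τ : ℝ, s₀ ≤ τ →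
          |F.c τ| < ε ^ ((1:ℝ)/4) ∧
          |F.d τ| < ε ^ ((1:ℝ)/4) ∧
          |F.Pi τ * F.E τ / F.H τ - 1| < 3 ∧
          (1/2) * (Real.exp s₀ * F.H s₀ - C₁ * Real.sqrt ε) < Real.exp τ * F.H τ ∧
          Real.exp τ * F.H τ < 2 * (Real.exp s₀ * F.H s₀ + C₁ * Real.sqrt ε) := by
  refine ⟨(1 / 10 ^ 12) ^ 4, 1, 2, by positivity, one_pos, one_lt_two, ?_⟩
  intro ε hε hε₀ F hF hB s hs hA _ hc hd hEH hlow hhigh hup _ hlo τ hτ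
  have hσ : 0 < ε ^ ((1:ℝ)/4) := rpow_pos_of_pos hε _
  have hσ4 : (ε ^ ((1:ℝ)/4)) ^ 4 = ε := by
    rw [← rpow_natCast, ← rpow_mul hε.le]; norm_num
  generalize ε ^ ((1:ℝ)/4) = σ at *
  subst hσ4
  have hσs : σ ≤ 1 / 10 ^ 12 := le_of_pow_le_pow_left₀ four_ne_zero (by norm_num) hε₀
  have hsqrt : √(σ ^ 4) = σ ^ 2 := by
    rw [show σ ^ 4 = (σ ^ 2) ^ 2 by ring, sqrt_sq (sq_nonneg σ)]
  have hexp : 1 < 2 * σ ^ 4 * exp s := by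
    rw [← div_eq_mul_inv, div_lt_iff₀ hε] at hlow
    linarith
  have hexp' : σ ^ 4 * exp s < 2 := by
    rwa [← div_eq_mul_inv, lt_div_iff₀ hε, mul_comm] at hhigh
  rw [hsqrt] at hup hlo ⊢
  have hκ : 1 / 2 ≤ exp s * F.H s := by nlinarith [sq_nonneg σ]
  have hk : 0 < √(exp s * F.H s / 10) := sqrt_pos.2 (by linarith)
  have hk2 : 10 * √(exp s * F.H s / 10) ^ 2 = exp s * F.H s := by
    rw [sq_sqrt (by linarith)]; ring
  have data : F.BootstrapData s (exp s * F.H s) √(exp s * F.H s / 10) σ := by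
    refine ⟨hF, hB, hA.le, hσ, hσs, rfl, hκ, by nlinarith [sq_nonneg σ], hk, hk2, ?_⟩
    refine le_of_sq_le_sq ?_ (by positivity)
    have := exp_neg_half_sq_mul s
    by_contra! hcon
    have := mul_lt_mul_of_pos_right hcon (exp_pos s)
    nlinarith
  obtain ⟨h0, hX⟩ := data.initial hc hd hEH
  exact data.conclusion h0 hX hτ
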